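/- arXiv:2301.05834 — 4 statements merged into one kernel-verified Lean document; each statement's English description precedes it below -/
import Mathlib

section
/- Let n ≥ 3 be an integer with n ≡ 3 (mod 15) and n ≠ 3. Then there is no lattice tiling of ℤⁿ by the error ball B(n,2,1,1). -/
/-- The error ball `B(n,2,1,1)`: vectors in `ℤⁿ` with entries in `{-1,0,1}`
and at most `2` nonzero coordinates. -/
def errBall (n : ℕ) : Set (Fin n → ℤ) :=
  {a | (∀ i, a i = -1 ∨ a i = 0 ∨ a i = 1) ∧
    (Finset.univ.filter (fun i => a i ≠ 0)).card ≤ 2}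

/-- A lattice tiling of `ℤⁿ` by `V`: a subgroup `L` such that every `x ∈ ℤⁿ`
is uniquely `v + l` with `v ∈ V`, `l ∈ L`. -/
def IsLatticeTiling (n : ℕ) (V : Set (Fin n → ℤ)) (L : AddSubgroup (Fin n → ℤ)) : Prop :=
  ∀ x : Fin n → ℤ, ∃! p : (Fin n → ℤ) × (Fin n → ℤ),
    p.1 ∈ V ∧ p.2 ∈ L ∧ x = p.1 + p.2

set_option linter.unusedSectionVars false
open AddMonoidAlgebra in
noncomputable def YY (R : Type) [CommRing R] {G ι : Type} [AddCommGroup G] [Fintype ι]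
    (y : ι → G) (k : ℕ) : AddMonoidAlgebra R G := ∑ a, single (k • y a) 1

open AddMonoidAlgebra in
noncomputable def GG (R G : Type) [CommRing R] [AddCommGroup G] [Fintype G] :
    AddMonoidAlgebra R G := ∑ g : G, single g 1

def ct1 {G ι : Type} [AddCommGroup G] [DecidableEq G] [Fintype ι] (y : ι → G) (k : ℕ) (g : G) : ℕ :=
  ∑ a, if k • y a = g then 1 else 0

def ct2 {G ι : Type} [AddCommGroup G] [DecidableEq G] [Fintype ι] (y : ι → G) (k l : ℕ) (g : G) :
    ℕ := ∑ a, ∑ b, if k • y a + l • y b = g then 1 else 0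

section
variable {R G ι : Type} [CommRing R] [AddCommGroup G] [Fintype G] [DecidableEq G] [Fintype ι]

lemma YY_coeff (y : ι → G) (k : ℕ) (g : G) : (YY R y k).coeff g = (ct1 y k g : R) := by
  simp [YY, ct1, AddMonoidAlgebra.coeff_sum, Finsupp.single_apply]

lemma YY_mul_coeff (y : ι → G) (k l : ℕ) (g : G) :
    (YY R y k * YY R y l).coeff g = (ct2 y k l g : R) := by
  simp only [YY, ct2, Finset.sum_mul_sum, AddMonoidAlgebra.coeff_sum, 
    AddMonoidAlgebra.single_mul_single, AddMonoidAlgebra.coeff_single, Finsupp.finsetSum_apply,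
    Finsupp.single_apply]
  simp

lemma GG_coeff (g : G) : (GG R G).coeff g = 1 := by
  simp [GG, AddMonoidAlgebra.coeff_sum, Finsupp.single_apply]

lemma single_mul_GG (x : G) : AddMonoidAlgebra.single x (1 : R) * GG R G = GG R G := by
  rw [GG, Finset.mul_sum]
  simp only [AddMonoidAlgebra.single_mul_single, one_mul]
  exact Equiv.sum_comp (Equiv.addLeft x) (fun g => AddMonoidAlgebra.single g (1 : R))

lemma YY_mul_GG (y : ι → G) (k : ℕ) :
    YY R y k * GG R G = (Fintype.card ι : AddMonoidAlgebra R G) * GG R G := by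
  conv_lhs => rw [YY, Finset.sum_mul]
  simp [single_mul_GG]

lemma GG_mul_GG : GG R G * GG R G = (Fintype.card G : AddMonoidAlgebra R G) * GG R G := by
  conv_lhs => 
    arg 1
    rw [GG]
  rw [Finset.sum_mul]
  simp [single_mul_GG]

lemma YY_pow (p : ℕ) [Fact p.Prime] [CharP R p] (y : ι → G) :
    YY R y 1 ^ p = YY R y p := by
  have : CharP (AddMonoidAlgebra R G) p := by
    refine charP_of_injective_ringHom (f := (AddMonoidAlgebra.singleZeroRingHom : R →+* AddMonoidAlgebra R G)) ?_ p
    intro a b hab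
    have := congrArg (fun f => f.coeff 0) hab
    simpa using this
  rw [YY, sum_pow_char p, YY]
  simp [AddMonoidAlgebra.single_pow]

lemma YY_double (hd : Function.Injective (fun g : G => 2 • g)) (y : ι → G) (m : ℕ)
    (key : YY R y 1 ^ 2 = 2 * GG R G + YY R y 2 + (m : AddMonoidAlgebra R G)) :
    YY R y 2 ^ 2 = 2 * GG R G + YY R y 4 + (m : AddMonoidAlgebra R G) := by
  let f : G →+ G := nsmulAddMonoidHom 2
  have hf : Function.Bijective f := Finite.injective_iff_bijective.1 hd
  let F := AddMonoidAlgebra.mapDomainRingHom R f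
  have h1 : ∀ k, F (YY R y k) = YY R y (2 * k) := by
    intro k
    simp [F, YY, f, mul_smul]
  have h2 : F (GG R G) = GG R G := by
    simp only [GG, map_sum]
    have : ∀ g : G, F (AddMonoidAlgebra.single g 1) = AddMonoidAlgebra.single (f g) 1 := by
      intro g; simp [F]
    simp only [this]
    exact Equiv.sum_comp (Equiv.ofBijective f hf) (fun g => AddMonoidAlgebra.single g (1 : R))
  have := congrArg F key
  have h3 : F 2 = 2 := map_ofNat F 2
  simpa [h1, h2, h3] using this

lemma conv_zero (f h : AddMonoidAlgebra R G) :
    (f * h).coeff 0 = ∑ g, f.coeff g * h.coeff (-g) := by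
  have : f = ∑ g, AddMonoidAlgebra.single g (f.coeff g) := by
    ext g
    simp [AddMonoidAlgebra.coeff_sum, Finsupp.single_apply]
  conv_lhs => rw [this, Finset.sum_mul]
  simp [AddMonoidAlgebra.coeff_sum]

lemma key3 (n : ℕ) (hn : n % 15 = 3) (hG : Fintype.card G = 2 * n ^ 2 + 1)
    (hi : Fintype.card ι = 2 * n + 1) (y : ι → G)
    (key : YY (ZMod 3) y 1 ^ 2 = 2 * GG (ZMod 3) G + YY (ZMod 3) y 2 + ((2 * n - 2 : ℕ) : AddMonoidAlgebra (ZMod 3) G)) :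
    YY (ZMod 3) y 1 * YY (ZMod 3) y 2 = YY (ZMod 3) y 3 - YY (ZMod 3) y 1 + GG (ZMod 3) G := by
  have : Fact (Nat.Prime 3) := ⟨by norm_num⟩
  have h3 := YY_pow (R := ZMod 3) 3 y
  have hyg := YY_mul_GG (R := ZMod 3) y 1
  obtain ⟨q, rfl⟩ : ∃ q, n = 15 * q + 3 := ⟨n / 15, by omega⟩
  have t0 : (3 : AddMonoidAlgebra (ZMod 3) G) = 0 := by
    have : (3 : ZMod 3) = 0 := by
      exact CharP.ofNat_eq_zero (ZMod 3) 3
    have h := congrArg (AddMonoidAlgebra.singleZeroRingHom : ZMod 3 →+* AddMonoidAlgebra (ZMod 3) G) this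
    simpa only [map_ofNat, map_zero] using h
  rw [hi] at hyg
  rw [show 2 * (15 * q + 3) - 2 = 30 * q + 4 by omega] at key
  push_cast at hyg key
  generalize YY (ZMod 3) y 1 = Y1 at *
  generalize YY (ZMod 3) y 2 = Y2 at *
  generalize YY (ZMod 3) y 3 = Y3 at *
  generalize GG (ZMod 3) G = g at *
  generalize (q : AddMonoidAlgebra (ZMod 3) G) = q at *
  have hyg' : Y1 * g = g := by linear_combination hyg + (10 * q + 2) * g * t0
  have key' : Y1 ^ 2 = 2 * g + Y2 + 1 := by linear_combination key + (10 * q + 1) * t0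
  linear_combination -Y1 * key' + h3 - 2 * hyg' - g * t0

lemma key5 (n : ℕ) (hn : n % 15 = 3) (hG : Fintype.card G = 2 * n ^ 2 + 1)
    (hi : Fintype.card ι = 2 * n + 1) (y : ι → G)
    (hd : Function.Injective (fun g : G => 2 • g))
    (key : YY (ZMod 5) y 1 ^ 2 = 2 * GG (ZMod 5) G + YY (ZMod 5) y 2 + ((2 * n - 2 : ℕ) : AddMonoidAlgebra (ZMod 5) G)) :
    YY (ZMod 5) y 1 * YY (ZMod 5) y 4 = YY (ZMod 5) y 5 + 2 * (YY (ZMod 5) y 1 * YY (ZMod 5) y 2)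
      + GG (ZMod 5) G := by
  have : Fact (Nat.Prime 5) := ⟨by norm_num⟩
  have h5 := YY_pow (R := ZMod 5) 5 y
  have hyg := YY_mul_GG (R := ZMod 5) y 1
  have hyg2 := YY_mul_GG (R := ZMod 5) y 2
  have keyd := YY_double hd y _ key
  obtain ⟨q, rfl⟩ : ∃ q, n = 15 * q + 3 := ⟨n / 15, by omega⟩
  have t0 : (5 : AddMonoidAlgebra (ZMod 5) G) = 0 := by
    have : (5 : ZMod 5) = 0 := by
      exact CharP.ofNat_eq_zero (ZMod 5) 5
    have h := congrArg (AddMonoidAlgebra.singleZeroRingHom : ZMod 5 →+* AddMonoidAlgebra (ZMod 5) G) this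
    simpa only [map_ofNat, map_zero] using h
  rw [hi] at hyg hyg2
  rw [show 2 * (15 * q + 3) - 2 = 30 * q + 4 by omega] at key keyd
  push_cast at hyg hyg2 key keyd
  generalize YY (ZMod 5) y 1 = Y1 at *
  generalize YY (ZMod 5) y 2 = Y2 at *
  generalize YY (ZMod 5) y 4 = Y4 at *
  generalize YY (ZMod 5) y 5 = Y5 at *
  generalize GG (ZMod 5) G = g at *
  generalize (q : AddMonoidAlgebra (ZMod 5) G) = q at *
  have hyg' : Y1 * g = 2 * g := by linear_combination hyg + (6 * q + 1) * g * t0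
  have hyg2' : Y2 * g = 2 * g := by linear_combination hyg2 + (6 * q + 1) * g * t0
  have key' : Y1 ^ 2 = 2 * g + Y2 - 1 := by linear_combination key + (6 * q + 1) * t0
  have keyd' : Y2 ^ 2 = 2 * g + Y4 - 1 := by linear_combination keyd + (6 * q + 1) * t0
  have a1 : Y1 * Y2 = Y1 ^ 3 + g + Y1 := by linear_combination -Y1 * key' - 2 * hyg' - g * t0
  have a2 : Y1 ^ 2 * g = 4 * g := by linear_combination (Y1 + 2) * hyg'
  have a3 : Y1 ^ 3 * Y2 = Y5 + 4 * g + Y1 ^ 3 := by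
    linear_combination Y1 ^ 2 * a1 + h5 + a2
  have a4 : Y1 * Y2 ^ 2 = Y5 + 4 * g + Y1 ^ 3 + 2 * g + Y1 * Y2 := by
    linear_combination Y2 * a1 + a3 + hyg2'
  linear_combination -Y1 * keyd' + a4 - 2 * hyg' - a1 + 0 * t0

lemma pointwise (c d a1 a3 a5 : ℕ) (h3 : (c : ZMod 3) = a3 - a1 + 1)
    (h5 : (d : ZMod 5) = a5 + 2 * c + 1) :
    (18 : ℤ) ≤ 6 * d + 20 * (a1 + a3 + a5) + ((c : ℤ) ^ 2 - 5 * c + 4) := by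
  by_cases h : a1 + a3 + a5 = 0
  · obtain ⟨rfl, rfl, rfl⟩ : a1 = 0 ∧ a3 = 0 ∧ a5 = 0 := by omega
    have h3' : c % 3 = 1 := by
      have : ((c : ℕ) : ZMod 3) = (1 : ℕ) := by simpa using h3
      exact (ZMod.natCast_eq_natCast_iff' _ _ _).1 this
    have h5' : d % 5 = (2 * c + 1) % 5 := by
      have : ((d : ℕ) : ZMod 5) = (2 * c + 1 : ℕ) := by simpa using h5
      exact (ZMod.natCast_eq_natCast_iff' _ _ _).1 this
    by_cases hc : 7 ≤ c
    · have : (7 : ℤ) ≤ c := by exact_mod_cast hc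
      have : (0 : ℤ) ≤ d := by positivity
      push_cast
      nlinarith
    · have : c = 1 ∨ c = 4 := by omega
      rcases this with rfl | rfl
      · have : 3 ≤ d := by omega
        push_cast
        omega
      · have : 3 ≤ d := by omega
        push_cast
        omega
  · have : (1 : ℤ) ≤ a1 + a3 + a5 := by exact_mod_cast Nat.one_le_iff_ne_zero.2 h
    have : (0 : ℤ) ≤ d := by positivity
    have : (0 : ℤ) ≤ ((c : ℤ) - 2) * (c - 3) := by
      by_cases hc : c ≤ 2
      · have : (c : ℤ) ≤ 2 := by exact_mod_cast hc
        nlinarith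
      · have : (3 : ℤ) ≤ c := by exact_mod_cast (by omega : 3 ≤ c)
        nlinarith
    nlinarith

lemma ct1_sum (y : ι → G) (k : ℕ) : ∑ g, ct1 y k g = Fintype.card ι := by
  unfold ct1
  rw [Finset.sum_comm]
  simp

lemma ct2_sum (y : ι → G) (k l : ℕ) : ∑ g, ct2 y k l g = Fintype.card ι ^ 2 := by
  unfold ct2
  rw [Finset.sum_comm]
  simp_rw [fun a => Finset.sum_comm (s := (Finset.univ : Finset G)) (t := (Finset.univ : Finset ι))
    (f := fun g b => if k • y a + l • y b = g then 1 else 0)]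
  simp [sq]

lemma ct2_neg (y : ι → G) (s : ι ≃ ι) (hs : ∀ a, y (s a) = - y a) (k l : ℕ) (g : G) :
    ct2 y k l (-g) = ct2 y k l g := by
  unfold ct2
  rw [← Equiv.sum_comp s]
  refine Finset.sum_congr rfl fun a _ => ?_
  rw [← Equiv.sum_comp s]
  refine Finset.sum_congr rfl fun b _ => ?_
  simp only [hs, smul_neg, ← neg_add, neg_inj]

lemma card_le (y : ι → G) (hd : Function.Injective (fun g : G => 2 • g))
    (hy : Function.Injective y) (g : G) : (∑ a, if 2 • y a = g then 1 else 0) ≤ 1 := by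
  classical
  rw [← Finset.card_filter, Finset.card_le_one]
  intro a ha b hb
  simp at ha hb
  exact hy (hd (by simp [ha, hb]))

lemma ct1_bd (y : ι → G) (hd : Function.Injective (fun g : G => 2 • g))
    (hy : Function.Injective y) : ct1 y 2 0 ≤ 1 := card_le y hd hy 0

lemma ct1_bd4 (y : ι → G) (hd : Function.Injective (fun g : G => 2 • g))
    (hy : Function.Injective y) : ct1 y 4 0 ≤ 1 := by
  have := card_le (fun a => 2 • y a) hd (hd.comp hy) 0
  simpa [ct1, smul_smul] using this

lemma ct2_bd (y : ι → G) (hd : Function.Injective (fun g : G => 2 • g))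
    (hy : Function.Injective y) : ct2 y 2 4 0 ≤ Fintype.card ι := by
  unfold ct2
  rw [Finset.sum_comm]
  calc _ ≤ ∑ b : ι, 1 := by
        refine Finset.sum_le_sum fun b _ => ?_
        have := card_le y hd hy (-(4 • y b))
        simpa only [eq_neg_iff_add_eq_zero] using this
    _ = _ := by simp

lemma moment (n : ℕ) (hn : 1 ≤ n) (hG : Fintype.card G = 2 * n ^ 2 + 1)
    (hi : Fintype.card ι = 2 * n + 1) (y : ι → G)
    (hd : Function.Injective (fun g : G => 2 • g))
    (hy : Function.Injective y) (s : ι ≃ ι) (hs : ∀ a, y (s a) = - y a)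
    (key : YY ℤ y 1 ^ 2 = 2 * GG ℤ G + YY ℤ y 2 + ((2 * n - 2 : ℕ) : AddMonoidAlgebra ℤ G)) :
    ∑ g, (ct2 y 1 2 g : ℤ) ^ 2 ≤ 12 * n ^ 2 + 14 * n + 1 := by
  have keyd := YY_double hd y _ key
  have e : ((YY ℤ y 1 * YY ℤ y 2) * (YY ℤ y 1 * YY ℤ y 2)).coeff 0 =
      ∑ g, (ct2 y 1 2 g : ℤ) ^ 2 := by
    rw [conv_zero]
    simp only [YY_mul_coeff, ct2_neg y s hs, sq]
  rw [← e]
  have hg2 := YY_mul_GG (R := ℤ) y 2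
  have hg4 := YY_mul_GG (R := ℤ) y 4
  have hgg := GG_mul_GG (R := ℤ) (G := G)
  rw [hi] at hg2 hg4
  rw [hG] at hgg
  obtain ⟨m, rfl⟩ : ∃ m, n = m + 1 := ⟨n - 1, by omega⟩
  rw [show 2 * (m + 1) - 2 = 2 * m by omega] at key keyd
  have E : (YY ℤ y 1 * YY ℤ y 2) * (YY ℤ y 1 * YY ℤ y 2) =
      (4 * (2 * (m + 1) ^ 2 + 1) + 4 * (2 * (m + 1) + 1) + 8 * m) • GG ℤ G + YY ℤ y 2 * YY ℤ y 4
      + (2 * m) • YY ℤ y 2 + (2 * m) • YY ℤ y 4 + (4 * m ^ 2) • 1 := by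
    simp only [nsmul_eq_mul]
    push_cast at *
    linear_combination YY ℤ y 2 ^ 2 * key + (2 * GG ℤ G + YY ℤ y 2 + 2 * (m : AddMonoidAlgebra ℤ G)) * keyd
      + 4 * hgg + 2 * hg2 + 2 * hg4
  rw [E]
  simp only [AddMonoidAlgebra.coeff_add, AddMonoidAlgebra.coeff_smul, Finsupp.add_apply,
    Finsupp.smul_apply, GG_coeff, YY_mul_coeff, YY_coeff]
  simp only [nsmul_eq_mul]
  have h1 : ((1 : AddMonoidAlgebra ℤ G)).coeff 0 = 1 := by
    simp [AddMonoidAlgebra.one_def]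
  rw [h1]
  have b1 : (ct1 y 2 0 : ℤ) ≤ 1 := by exact_mod_cast ct1_bd y hd hy
  have b2 : (ct1 y 4 0 : ℤ) ≤ 1 := by exact_mod_cast ct1_bd4 y hd hy
  have b3 : (ct2 y 2 4 0 : ℤ) ≤ 2 * (m + 1) + 1 := by
    have := ct2_bd y hd hy
    rw [hi] at this
    exact_mod_cast this
  have b0 : (0 : ℤ) ≤ m := by positivity
  push_cast
  nlinarith

lemma core (n : ℕ) (hn : n % 15 = 3) (hn' : 18 ≤ n)
    (hi : Fintype.card ι = 2 * n + 1) (y : ι → G)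
    (hy : Function.Injective y) (s : ι ≃ ι) (hs : ∀ a, y (s a) = - y a)
    (key : ∀ (R : Type) [CommRing R],
      YY R y 1 ^ 2 = 2 * GG R G + YY R y 2 + ((2 * n - 2 : ℕ) : AddMonoidAlgebra R G)) : False := by
  have hG : Fintype.card G = 2 * n ^ 2 + 1 := by
    have k := key ℤ
    have h1 := YY_mul_GG (R := ℤ) y 1
    have h2 := YY_mul_GG (R := ℤ) y 2
    have h3 := GG_mul_GG (R := ℤ) (G := G)
    rw [hi] at h1 h2
    obtain ⟨m, rfl⟩ : ∃ m, n = m + 1 := ⟨n - 1, by omega⟩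
    rw [show 2 * (m + 1) - 2 = 2 * m by omega] at k
    have E : ((2 * (m + 1) + 1) ^ 2) • GG ℤ G =
        (2 * Fintype.card G + (2 * (m + 1) + 1) + 2 * m) • GG ℤ G := by
      simp only [nsmul_eq_mul]
      push_cast at *
      linear_combination GG ℤ G * k + 2 * h3 + h2 - (YY ℤ y 1 + 2 * (m + 1) + 1) * h1
    have E' := congrArg (fun f => f.coeff 0) E
    simp only [AddMonoidAlgebra.coeff_smul, Finsupp.smul_apply, GG_coeff] at E'
    simp only [nsmul_eq_mul, mul_one] at E'
    have E'' : (2 * (m + 1) + 1) ^ 2 = 2 * Fintype.card G + (2 * (m + 1) + 1) + 2 * m := by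
      exact_mod_cast E'
    nlinarith
  have hd : Function.Injective (fun g : G => 2 • g) := by
    have : (Nat.card G).Coprime 2 := by
      rw [Nat.card_eq_fintype_card, hG]
      simp
    exact (nsmulCoprime this).injective
  have k3 := key3 n hn hG hi y (key _)
  have k5 := key5 n hn hG hi y hd (key _)
  have mo := moment n (by omega) hG hi y hd hy s hs (key _)
  have pw : ∀ g : G, (18 : ℤ) ≤ 6 * ct2 y 1 4 g + 20 * (ct1 y 1 g + ct1 y 3 g + ct1 y 5 g) +
      ((ct2 y 1 2 g : ℤ) ^ 2 - 5 * ct2 y 1 2 g + 4) := by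
    intro g
    apply pointwise
    · rw [← YY_mul_coeff, k3]
      simp [YY_coeff, GG_coeff]
    · rw [← YY_mul_coeff, k5, two_mul]
      simp [YY_coeff, GG_coeff, YY_mul_coeff, two_mul]
  have S := Finset.sum_le_sum (fun g (_ : g ∈ (Finset.univ : Finset G)) => pw g)
  simp only [Finset.sum_add_distrib, Finset.sum_sub_distrib, ← Finset.mul_sum, ← Nat.cast_sum,
    ct1_sum, ct2_sum, Finset.sum_const, Finset.card_univ, hG, hi] at S
  simp only [nsmul_eq_mul] at S
  push_cast at S
  have : (18 : ℤ) ≤ n := by exact_mod_cast hn'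
  nlinarith
end

section
variable {n : ℕ}

def wv (n : ℕ) : Option (Fin n × ℤˣ) → (Fin n → ℤ)
  | none => 0
  | some (i, e) => Pi.single i (e : ℤ)

def wp (n : ℕ) : Option (Fin n × ℤˣ) ⊕ ({p : Fin n × Fin n // p.1 < p.2} × ℤˣ × ℤˣ) → (Fin n → ℤ)
  | Sum.inl a => wv n a
  | Sum.inr (p, e, d) => Pi.single p.1.1 (e : ℤ) + Pi.single p.1.2 (d : ℤ)

lemma wp_mem (p) : wp n p ∈ errBall n := by
  have hu : ∀ e : ℤˣ, (e : ℤ) = -1 ∨ (e : ℤ) = 0 ∨ (e : ℤ) = 1 := by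
    intro e
    rcases Int.units_eq_one_or e with rfl | rfl <;> simp
  rcases p with (_ | ⟨i, e⟩) | ⟨⟨⟨i, j⟩, hij⟩, e, d⟩
  · simp [wp, wv, errBall]
  · refine ⟨fun k => ?_, ?_⟩
    · by_cases h : k = i
      · subst h; simpa [wp, wv] using hu e
      · simp [wp, wv, Pi.single_apply, h]
    · calc _ ≤ ({i} : Finset (Fin n)).card := by
            apply Finset.card_le_card
            intro k
            simp +contextual [wp, wv, Pi.single_apply]
        _ ≤ 2 := by simp
  · have hij' : i < j := hij
    refine ⟨fun k => ?_, ?_⟩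
    · by_cases h : k = i
      · subst h; simpa [wp, Pi.single_apply, hij'.ne] using hu e
      · by_cases h' : k = j
        · subst h'; simpa [wp, Pi.single_apply, hij'.ne'] using hu d
        · simp [wp, Pi.single_apply, h, h']
    · calc _ ≤ ({i, j} : Finset (Fin n)).card := by
            apply Finset.card_le_card
            intro k
            simp only [wp, Finset.mem_filter, Finset.mem_univ, true_and, Finset.mem_insert,
              Finset.mem_singleton, Pi.add_apply, Pi.single_apply]
            intro h
            by_contra hc
            push Not at hc
            simp [hc.1, hc.2] at h
        _ ≤ 2 := Finset.card_le_two

lemma wp_inj : Function.Injective (wp n) := by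
  have hu : ∀ e : ℤˣ, (e : ℤ) ≠ 0 := fun e => e.ne_zero
  rintro ((_ | ⟨i, e⟩) | ⟨⟨⟨i, j⟩, hij⟩, e, d⟩) ((_ | ⟨i', e'⟩) | ⟨⟨⟨i', j'⟩, hij'⟩, e', d'⟩) h
  · rfl
  · have := congrFun h i'
    simp [wp, wv] at this
    exact absurd this.symm (hu e')
  · have := congrFun h i'
    have h1 : i' < j' := hij'
    simp [wp, wv, h1.ne] at this
    exact absurd this.symm (hu e')
  · have := congrFun h i
    simp [wp, wv] at this
  · have h1 := congrFun h i
    have h2 := congrFun h i'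
    have he := hu e
    simp only [wp, wv, Pi.single_apply] at h1 h2
    have : i = i' := by
      by_contra hc
      simp [hc] at h1
    subst this
    simp at h1
    have h1 : e = e' := Units.ext h1
    rw [h1]
  · exfalso
    have h0 : i' < j' := hij'
    have h2 := congrFun h i'
    have h3 := congrFun h j'
    have he := hu e'
    have hd := hu d'
    simp only [wp, wv, Pi.single_apply, Pi.add_apply] at h2 h3
    grind
  · exfalso
    have h0 : i < j := hij
    have := congrFun h i
    simp [wp, wv, Pi.single_apply, h0.ne] at this
  · exfalso
    have h0 : i < j := hij
    have h2 := congrFun h i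
    have h3 := congrFun h j
    have he := hu e
    have hd := hu d
    simp only [wp, wv, Pi.single_apply, Pi.add_apply] at h2 h3
    grind
  · have h0 : i < j := hij
    have h0' : i' < j' := hij'
    have h1 := congrFun h i
    have h2 := congrFun h j
    have h3 := congrFun h i'
    have h4 := congrFun h j'
    have he := hu e
    have hd := hu d
    have he' := hu e'
    have hd' := hu d'
    simp only [wp, Pi.single_apply, Pi.add_apply] at h1 h2 h3 h4
    have q : i = i' ∧ j = j' := by grind
    obtain ⟨rfl, rfl⟩ := q
    simp [h0.ne, h0.ne'] at h1 h2
    have h1 : e = e' := Units.ext h1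
    have h2 : d = d' := Units.ext h2
    rw [h1, h2]

lemma wp_surj (v : Fin n → ℤ) (hv : v ∈ errBall n) : ∃ p, wp n p = v := by
  obtain ⟨h1, h2⟩ := hv
  have hu : ∀ i, v i ≠ 0 → ∃ e : ℤˣ, (e : ℤ) = v i := by
    intro i hi
    rcases h1 i with h | h | h
    · exact ⟨-1, by simp [h]⟩
    · exact absurd h hi
    · exact ⟨1, by simp [h]⟩
  have hm : ∀ k, k ∈ Finset.univ.filter (fun i => v i ≠ 0) ↔ v k ≠ 0 := by simp
  generalize hS : Finset.univ.filter (fun i => v i ≠ 0) = S at *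
  have : S.card = 0 ∨ S.card = 1 ∨ S.card = 2 := by omega
  rcases this with h | h | h
  · rw [Finset.card_eq_zero] at h
    subst h
    refine ⟨Sum.inl none, ?_⟩
    ext k
    have := hm k
    simp at this
    simp [wp, wv, this]
  · obtain ⟨i, rfl⟩ := Finset.card_eq_one.1 h
    obtain ⟨e, he⟩ := hu i ((hm i).1 (by simp))
    refine ⟨Sum.inl (some (i, e)), ?_⟩
    ext k
    have := hm k
    by_cases hk : k = i
    · subst hk; simp [wp, wv, he]
    · simp [hk] at this
      simp [wp, wv, hk, this]
  · obtain ⟨i, j, hij, rfl⟩ := Finset.card_eq_two.1 h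
    have aux : ∀ i j : Fin n, i < j → (∀ k, k ∈ ({i, j} : Finset (Fin n)) ↔ v k ≠ 0) →
        ∃ p, wp n p = v := by
      intro i j hlt hm
      obtain ⟨e, he⟩ := hu i ((hm i).1 (by simp))
      obtain ⟨d, hd⟩ := hu j ((hm j).1 (by simp))
      refine ⟨Sum.inr (⟨(i, j), hlt⟩, e, d), ?_⟩
      ext k
      have := hm k
      by_cases hk : k = i
      · subst hk; simp [wp, he, Pi.single_apply, hlt.ne]
      · by_cases hk' : k = j
        · subst hk'; simp [wp, hd, Pi.single_apply, hlt.ne']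
        · simp [hk, hk'] at this
          simp [wp, hk, hk', this]
    rcases lt_or_gt_of_ne hij with hl | hl
    · exact aux i j hl hm
    · exact aux j i hl (by rw [Finset.pair_comm]; exact hm)

lemma sum_sq_split {A : Type} [CommRing A] (u : Fin n → A) :
    (∑ i, u i) ^ 2 = ∑ i, u i ^ 2 + 2 * ∑ p : {p : Fin n × Fin n // p.1 < p.2}, u p.1.1 * u p.1.2 := by
  have e1 : ∑ p : {p : Fin n × Fin n // p.1 < p.2}, u p.1.1 * u p.1.2 =
      ∑ i, ∑ j, if i < j then u i * u j else 0 := by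
    rw [← Finset.sum_subtype (Finset.univ.filter (fun p : Fin n × Fin n => p.1 < p.2))
      (by simp) (fun p => u p.1 * u p.2), Finset.sum_filter, Fintype.sum_prod_type]
  have e2 : ∑ i, ∑ j, (if i < j then u i * u j else 0) =
      ∑ i, ∑ j, if j < i then u i * u j else 0 := by
    rw [Finset.sum_comm]
    simp only [mul_comm]
  have e3 : ∑ i, u i ^ 2 = ∑ i, ∑ j, if i = j then u i * u j else 0 := by
    simp [sq]
  rw [two_mul, e1]
  nth_rw 2 [e2]
  rw [e3, sq, Finset.sum_mul_sum, ← Finset.sum_add_distrib, ← Finset.sum_add_distrib]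
  refine Finset.sum_congr rfl fun i _ => ?_
  rw [← Finset.sum_add_distrib, ← Finset.sum_add_distrib]
  refine Finset.sum_congr rfl fun j _ => ?_
  rcases lt_trichotomy i j with h | h | h
  · simp [h, h.ne, h.not_gt]
  · simp [h]
  · simp [h, h.ne', h.not_gt]

lemma units_sum {A : Type} [AddCommMonoid A] (f : ℤˣ → A) : ∑ e, f e = f 1 + f (-1) := by
  rw [show (Finset.univ : Finset ℤˣ) = {1, -1} from rfl]
  rw [Finset.sum_pair (by decide)]

lemma main_key {G : Type} [AddCommGroup G] [Fintype G] (hn : 1 ≤ n) (π : (Fin n → ℤ) →+ G)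
    (hb : Function.Bijective (fun p => π (wp n p))) (R : Type) [CommRing R] :
    YY R (fun a => π (wv n a)) 1 ^ 2 =
      2 * GG R G + YY R (fun a => π (wv n a)) 2 + ((2 * n - 2 : ℕ) : AddMonoidAlgebra R G) := by
  let x : Fin n → ℤˣ → AddMonoidAlgebra R G := fun i e =>
    AddMonoidAlgebra.single (π (Pi.single i (e : ℤ))) 1
  let u : Fin n → AddMonoidAlgebra R G := fun i => ∑ e, x i e
  have hY : YY R (fun a => π (wv n a)) 1 = 1 + ∑ i, u i := by
    simp [YY, Fintype.sum_option, Fintype.sum_prod_type, wv, u, x, AddMonoidAlgebra.one_def]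
  have hG : GG R G = 1 + ∑ i, u i + ∑ p : {p : Fin n × Fin n // p.1 < p.2}, u p.1.1 * u p.1.2 := by
    rw [GG, ← Equiv.sum_comp (Equiv.ofBijective _ hb), Fintype.sum_sum_type]
    congr 1
    · rw [← hY]
      simp [YY, wp]
    · rw [Fintype.sum_prod_type]
      refine Finset.sum_congr rfl fun p _ => ?_
      simp only [u, Finset.sum_mul_sum, Fintype.sum_prod_type, x,
        AddMonoidAlgebra.single_mul_single, one_mul, ← map_add]
      rfl
  have hx : ∀ i, x i 1 * x i (-1) = 1 := by
    intro i
    simp only [x, AddMonoidAlgebra.single_mul_single, ← map_add, ← Pi.single_add]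
    simp [AddMonoidAlgebra.one_def]
  have hY2 : YY R (fun a => π (wv n a)) 2 = 1 + ∑ i, (x i 1 ^ 2 + x i (-1) ^ 2) := by
    simp [YY, Fintype.sum_option, Fintype.sum_prod_type, wv, units_sum, x,
      AddMonoidAlgebra.single_pow, AddMonoidAlgebra.one_def]
  have hu2 : ∑ i, u i ^ 2 = ∑ i, (x i 1 ^ 2 + x i (-1) ^ 2) + 2 * (n : AddMonoidAlgebra R G) := by
    have : ∀ i, u i ^ 2 = (x i 1 ^ 2 + x i (-1) ^ 2) + 2 := by
      intro i
      simp only [u, units_sum]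
      linear_combination 2 * hx i
    simp only [this]
    rw [Finset.sum_add_distrib]
    simp [mul_comm]
  have hs := sum_sq_split u
  obtain ⟨m, rfl⟩ : ∃ m, n = m + 1 := ⟨n - 1, by omega⟩
  rw [show 2 * (m + 1) - 2 = 2 * m by omega]
  push_cast at *
  rw [hY, hY2, hG]
  linear_combination hs + hu2
end

theorem stmt15 (n : ℕ) (hn : 3 ≤ n) (hmod : n % 15 = 3) (h3 : n ≠ 3) :
    ¬ ∃ L : AddSubgroup (Fin n → ℤ), IsLatticeTiling n (errBall n) L := by
  classical
  rintro ⟨L, hL⟩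
  let π : (Fin n → ℤ) →+ (Fin n → ℤ) ⧸ L := QuotientAddGroup.mk' L
  have hb : Function.Bijective (fun p => π (wp n p)) := by
    constructor
    · intro p q hpq
      apply wp_inj
      have h : -(wp n p) + wp n q ∈ L := QuotientAddGroup.eq.1 hpq
      obtain ⟨r, _, hr⟩ := hL (wp n q)
      have e1 := hr (wp n q, 0) ⟨wp_mem q, L.zero_mem, by simp⟩
      have e2 := hr (wp n p, -(wp n p) + wp n q) ⟨wp_mem p, h, by simp⟩
      exact congrArg Prod.fst (e2.trans e1.symm)
    · intro g
      obtain ⟨x, rfl⟩ := QuotientAddGroup.mk'_surjective L g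
      obtain ⟨⟨v, l⟩, ⟨hv, hl, hx⟩, _⟩ := hL x
      obtain ⟨p, hp⟩ := wp_surj v hv
      refine ⟨p, ?_⟩
      simp only at hl hx
      change (QuotientAddGroup.mk (wp n p) : (Fin n → ℤ) ⧸ L) = QuotientAddGroup.mk x
      rw [QuotientAddGroup.eq, hp, hx]
      simpa using hl
  have : Finite ((Fin n → ℤ) ⧸ L) := Finite.of_surjective _ hb.2
  have : Fintype ((Fin n → ℤ) ⧸ L) := Fintype.ofFinite _
  refine core n hmod (by omega) (ι := Option (Fin n × ℤˣ)) ?_ (fun a => π (wv n a)) ?_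
    (Equiv.optionCongr ((Equiv.refl (Fin n)).prodCongr (Equiv.neg ℤˣ))) ?_
    (fun R _ => main_key (by omega) π hb R)
  · simp [mul_comm]
  · intro a b hab
    have := hb.1 (a₁ := Sum.inl a) (a₂ := Sum.inl b) hab
    exact Sum.inl_injective this
  · rintro (_ | ⟨i, e⟩)
    · simp [wv]
    · simp [wv, Pi.single_neg]
end

section
/- Let n ≥ 3 be an integer with n ≡ 0 (mod 15). Then there is no lattice tiling of ℤⁿ by the error ball B(n,2,1,1). -/
set_option linter.unusedSimpArgs false

namespace ETile

open AddMonoidAlgebra Finset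

/-- sign -/
def sg (b : Bool) : ℤ := if b then 1 else -1

/-- index type of the ball -/
abbrev Idx (n : ℕ) : Type :=
  Unit ⊕ (Fin n × Bool) ⊕ ({p : Fin n × Fin n // p.1 < p.2} × Bool × Bool)

/-- value -/
def vl {n : ℕ} {G : Type} [AddCommGroup G] (s : Fin n → G) : Idx n → G
  | Sum.inl _ => 0
  | Sum.inr (Sum.inl x) => sg x.2 • s x.1
  | Sum.inr (Sum.inr x) => sg x.2.1 • s x.1.1.1 + sg x.2.2 • s x.1.1.2

/-- group ring element -/
noncomputable def T {n : ℕ} {G : Type} [AddCommGroup G] (s : Fin n → G) : AddMonoidAlgebra ℤ G :=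
  ∑ x : Fin n × Bool, single (sg x.2 • s x.1) 1

/-- all-one element -/
noncomputable def U (G : Type) [AddCommGroup G] [Fintype G] : AddMonoidAlgebra ℤ G :=
  ∑ g : G, single g 1

section
variable {n : ℕ} {G : Type} [AddCommGroup G]

lemma vl_map {H : Type} [AddCommGroup H] (f : G →+ H) (s : Fin n → G) (x : Idx n) :
    vl (fun i => f (s i)) x = f (vl s x) := by
  rcases x with _ | x | x <;> simp [vl]

lemma sum_sq_lt {R : Type*} [CommRing R] (x : Fin n → R) :
    (∑ i, x i) ^ 2 = ∑ i, x i ^ 2 +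
      2 * ∑ p : {p : Fin n × Fin n // p.1 < p.2}, x p.1.1 * x p.1.2 := by
  have h0 : ∑ p : {p : Fin n × Fin n // p.1 < p.2}, x p.1.1 * x p.1.2
      = ∑ i, ∑ j, if i < j then x i * x j else 0 := by
    rw [← Fintype.sum_prod_type' (f := fun i j => if i < j then x i * x j else 0),
      ← Finset.sum_filter]
    exact (Finset.sum_subtype (Finset.univ.filter (fun p : Fin n × Fin n => p.1 < p.2))
      (by simp) (fun p => x p.1 * x p.2)).symm
  have h1 : ∑ i, ∑ j, (if i < j then x i * x j else 0)
      = ∑ i, ∑ j, (if j < i then x i * x j else 0) := by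
    rw [Finset.sum_comm]
    simp only [mul_comm]
  have h2 : ∑ i, x i ^ 2 = ∑ i, ∑ j, (if i = j then x i * x j else 0) := by
    simp [sq]
  rw [two_mul, h0]
  nth_rewrite 2 [h1]
  rw [h2, sq, Finset.sum_mul_sum, ← Finset.sum_add_distrib, ← Finset.sum_add_distrib]
  refine Finset.sum_congr rfl fun i _ => ?_
  rw [← Finset.sum_add_distrib, ← Finset.sum_add_distrib]
  refine Finset.sum_congr rfl fun j _ => ?_
  rcases lt_trichotomy i j with h | h | h
  · simp [h, h.ne, h.not_gt]
  · simp [h]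
  · simp [h, h.ne', h.not_gt]

lemma T_sq [Fintype G] (s : Fin n → G) (hs : Function.Bijective (vl s)) :
    (T s) ^ 2 = 2 * U G - 2 * T s + T (fun i => 2 • s i) + 2 * (n : AddMonoidAlgebra ℤ G) - 2 := by
  have hU : U G = ∑ x : Idx n, single (vl s x) 1 :=
    (hs.sum_comp (fun g => (single g 1 : AddMonoidAlgebra ℤ G))).symm
  have hT : ∀ s : Fin n → G, T s = ∑ i, ∑ b, (single (sg b • s i) 1 : AddMonoidAlgebra ℤ G) := by
    intro s
    rw [T, Fintype.sum_prod_type]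
  rw [hU, Fintype.sum_sum_type, Fintype.sum_sum_type]
  have e1 : ∑ x : Fin n × Bool, (single (vl s (Sum.inr (Sum.inl x))) 1 : AddMonoidAlgebra ℤ G)
     = T s := rfl
  have e2 : ∑ x : {p : Fin n × Fin n // p.1 < p.2} × Bool × Bool,
      (single (vl s (Sum.inr (Sum.inr x))) 1 : AddMonoidAlgebra ℤ G) =
      ∑ p : {p : Fin n × Fin n // p.1 < p.2},
        (∑ b, (single (sg b • s p.1.1) 1 : AddMonoidAlgebra ℤ G)) *
        (∑ b, (single (sg b • s p.1.2) 1 : AddMonoidAlgebra ℤ G)) := by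
    rw [Fintype.sum_prod_type]
    refine Finset.sum_congr rfl fun p _ => ?_
    rw [Finset.sum_mul_sum, Fintype.sum_prod_type]
    simp [vl, single_mul_single]
  have e3 : ∀ i, (∑ b, (single (sg b • s i) 1 : AddMonoidAlgebra ℤ G)) ^ 2
      = ∑ b, (single (sg b • (2 • s i)) 1 : AddMonoidAlgebra ℤ G) + 2 := by
    intro i
    have h1 : (2 : AddMonoidAlgebra ℤ G) = 1 + 1 := by norm_num
    rw [h1]
    simp only [Fintype.sum_bool, sg, sq, add_mul, mul_add, single_mul_single, one_def, two_nsmul,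
      if_true, one_smul, mul_one, Bool.false_eq_true, if_false, neg_smul, neg_add,
      add_neg_cancel, neg_add_cancel]
    abel
  have e4 := sum_sq_lt (fun i => ∑ b, (single (sg b • s i) 1 : AddMonoidAlgebra ℤ G))
  rw [← hT s] at e4
  rw [e1, e2, e4, hT (fun i => 2 • s i)]
  simp only [e3, Finset.sum_add_distrib]
  simp only [vl, Finset.univ_unique, Finset.sum_const, Finset.card_singleton, Finset.card_univ,
    Fintype.card_fin, one_smul, nsmul_eq_mul, ← one_def]
  ring

lemma single_mul_U [Fintype G] (g : G) : (single g 1 : AddMonoidAlgebra ℤ G) * U G = U G := by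
  rw [U, Finset.mul_sum]
  simp only [single_mul_single, mul_one]
  exact Equiv.sum_comp (Equiv.addLeft g) (fun h => (single h 1 : AddMonoidAlgebra ℤ G))

lemma T_mul_U [Fintype G] (s : Fin n → G) : T s * U G = 2 * (n : AddMonoidAlgebra ℤ G) * U G := by
  rw [T, Finset.sum_mul]
  simp only [single_mul_U]
  simp
  ring

lemma U_mul_U [Fintype G] : U G * U G = (Fintype.card G : AddMonoidAlgebra ℤ G) * U G := by
  nth_rewrite 1 [U]
  rw [Finset.sum_mul]
  simp [single_mul_U]

lemma U_coeff [Fintype G] (g : G) : (U G).coeff g = 1 := by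
  classical
  simp [U, coeff_sum, Finsupp.finsetSum_apply, Finsupp.single_apply]

lemma mul_coeff [Fintype G] (A B : AddMonoidAlgebra ℤ G) (g : G) :
    (A * B).coeff g = ∑ h, A.coeff h * B.coeff (g - h) := by
  rw [coeff_mul_apply_left, Finsupp.sum_fintype _ _ (by simp)]
  simp [sub_eq_neg_add]

lemma sum_coeff [Fintype G] (A : AddMonoidAlgebra ℤ G) :
    ∑ g, A.coeff g = (A * U G).coeff 0 := by
  simp [mul_coeff, U_coeff]

lemma sum_prod_coeff [Fintype G] (A B : AddMonoidAlgebra ℤ G)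
    (hB : ∀ g, B.coeff (-g) = B.coeff g) :
    ∑ g, A.coeff g * B.coeff g = (A * B).coeff 0 := by
  simp [mul_coeff, hB]

lemma mul_symm [Fintype G] (A B : AddMonoidAlgebra ℤ G)
    (hA : ∀ g, A.coeff (-g) = A.coeff g) (hB : ∀ g, B.coeff (-g) = B.coeff g) (g : G) :
    (A * B).coeff (-g) = (A * B).coeff g := by
  rw [mul_coeff, mul_coeff, ← Equiv.sum_comp (Equiv.neg G)]
  refine Finset.sum_congr rfl fun h _ => ?_
  rw [Equiv.neg_apply, hA, ← hB]
  congr 2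
  abel

lemma T_coeff [DecidableEq G] (s : Fin n → G) (g : G) :
    (T s).coeff g = ∑ x : Fin n × Bool, if sg x.2 • s x.1 = g then 1 else 0 := by
  simp [T, coeff_sum, Finsupp.finsetSum_apply, Finsupp.single_apply]

lemma T_symm (s : Fin n → G) (g : G) : (T s).coeff (-g) = (T s).coeff g := by
  classical
  rw [T_coeff, T_coeff, Fintype.sum_prod_type, Fintype.sum_prod_type]
  refine Finset.sum_congr rfl fun i _ => ?_
  simp only [Fintype.sum_bool, sg]
  simp [neg_eq_iff_eq_neg, add_comm]

lemma T_01 (s : Fin n → G) (hs : Function.Bijective (vl s)) (g : G) :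
    (T s).coeff g = 0 ∨ (T s).coeff g = 1 := by
  classical
  rw [T_coeff]
  by_cases h : ∃ x : Fin n × Bool, sg x.2 • s x.1 = g
  · right
    obtain ⟨x, hx⟩ := h
    rw [Finset.sum_eq_single x]
    · simp [hx]
    · intro y _ hy
      rw [if_neg]
      intro hy2
      apply hy
      have : vl s (Sum.inr (Sum.inl y)) = vl s (Sum.inr (Sum.inl x)) := by
        simp only [vl]; rw [hx, hy2]
      simpa using hs.1 this
    · simp
  · left
    push Not at h
    exact Finset.sum_eq_zero fun x _ => if_neg (h x)

lemma T_zero (s : Fin n → G) (hs : Function.Bijective (vl s)) :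
    (T s).coeff 0 = 0 := by
  classical
  rw [T_coeff]
  refine Finset.sum_eq_zero fun x _ => if_neg fun h => ?_
  have : vl s (Sum.inr (Sum.inl x)) = vl s (Sum.inl ()) := by simpa [vl] using h
  simpa using hs.1 this

lemma T_nonneg (s : Fin n → G) (g : G) : 0 ≤ (T s).coeff g := by
  classical
  rw [T_coeff]
  exact Finset.sum_nonneg fun x _ => by split_ifs <;> norm_num

lemma mul_nonneg' [Fintype G] (A B : AddMonoidAlgebra ℤ G)
    (hA : ∀ g, 0 ≤ A.coeff g) (hB : ∀ g, 0 ≤ B.coeff g) (g : G) :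
    0 ≤ (A * B).coeff g := by
  rw [mul_coeff]
  exact Finset.sum_nonneg fun x _ => mul_nonneg (hA _) (hB _)

lemma T_dbl (k : ℕ) (hk : Function.Injective (fun g : G => k • g)) (s : Fin n → G) (g : G) :
    (T (fun i => k • s i)).coeff (k • g) = (T s).coeff g := by
  classical
  rw [T_coeff, T_coeff]
  refine Finset.sum_congr rfl fun x _ => ?_
  have : sg x.2 • k • s x.1 = k • g ↔ sg x.2 • s x.1 = g := by
    rw [smul_comm]
    exact hk.eq_iff
  simp only [this]

lemma frob {R ι : Type*} [CommRing R] (p : ℕ) (hp : p.Prime) (S : Finset ι) (f : ι → R) :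
    ∃ r, (∑ i ∈ S, f i) ^ p = ∑ i ∈ S, f i ^ p + p * r := by
  classical
  induction S using Finset.induction_on with
  | empty => exact ⟨0, by simp [hp.ne_zero]⟩
  | insert a S ha ih =>
    obtain ⟨r, hr⟩ := ih
    obtain ⟨r', hr'⟩ := exists_add_pow_prime_eq hp (f a) (∑ i ∈ S, f i)
    refine ⟨r + f a * (∑ i ∈ S, f i) * r', ?_⟩
    rw [Finset.sum_insert ha, Finset.sum_insert ha, hr', hr]
    ring

lemma T_frob (p : ℕ) (hp : p.Prime) (s : Fin n → G) :
    ∃ r, (T s) ^ p = T (fun i => p • s i) + p * r := by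
  obtain ⟨r, hr⟩ := frob p hp Finset.univ
    (fun x : Fin n × Bool => (single (sg x.2 • s x.1) 1 : AddMonoidAlgebra ℤ G))
  refine ⟨r, ?_⟩
  rw [T, hr, T]
  simp only [single_pow, one_pow, smul_comm (_ : ℤ) p]

lemma good_smul [Fintype G] (k : ℕ) (hk : Function.Bijective (fun g : G => k • g)) (s : Fin n → G)
    (hs : Function.Bijective (vl s)) : Function.Bijective (vl (fun i => k • s i)) := by
  have : vl (fun i => k • s i) = (fun g : G => k • g) ∘ vl s := by
    funext x
    exact vl_map (nsmulAddMonoidHom k) s x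
  rw [this]
  exact hk.comp hs

lemma ring3 {R : Type*} [CommRing R] {a b A3 U r m n : R} (hn : n = 15 * m)
    (h1 : a ^ 2 = 2 * U - 2 * a + b + 2 * n - 2) (h3 : a * U = 2 * n * U)
    (h6 : a ^ 3 = A3 + 3 * r) : ∃ X, a * b = A3 + U + a + 2 * b + 2 + 3 * X := by
  subst hn
  refine ⟨r+U-20*m*U - a -2+20*m -10*m*a, ?_⟩
  linear_combination h6 - 2 * h3 - (a - 2) * h1

lemma ring5 {R : Type*} [CommRing R] {a b q A5 U r m n : R} (hn : n = 15 * m)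
    (h1 : a ^ 2 = 2 * U - 2 * a + b + 2 * n - 2)
    (h2 : b ^ 2 = 2 * U - 2 * b + q + 2 * n - 2) (h3 : a * U = 2 * n * U)
    (hU : U * U = (2 * n ^ 2 + 1) * U)
    (h6 : a ^ 5 = A5 + 5 * r) :
    ∃ X, a * q = - (a * b) + A5 - q - b + a + 2 - 2 * U + 5 * X := by
  subst hn
  have hb : b = a ^ 2 - 2 * U + 2 * a - 2 * (15 * m) + 2 := by linear_combination -h1
  have hq : q = b ^ 2 - 2 * U + 2 * b - 2 * (15 * m) + 2 := by linear_combination -h2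
  have h21 : a ^ 2 * U = (2 * (15 * m)) ^ 2 * U := by
    linear_combination (a + 2 * (15 * m)) * h3
  have h31 : a ^ 3 * U = (2 * (15 * m)) ^ 3 * U := by
    linear_combination a ^ 2 * h3 + 2 * (15 * m) * h21
  have h12 : a * U ^ 2 = (2 * (15 * m)) * (2 * (15 * m) ^ 2 + 1) * U := by
    linear_combination U * h3 + 2 * (15 * m) * hU
  refine ⟨r + ((-10800)*U^1*m^3 + (1)*a^4 + (-12)*a^3*m^1 + (3)*a^3 + (-96)*U^1*m^1 + (-1080)*U^1*m^2 + (-36)*a^2*m^1 + (5)*a^2 + (180)*a^1*m^2 + (-72)*a^1*m^1 + (5)*a^1 + (-2)*U^1 + (180)*m^2 + (-48)*m^1 + (2)), ?_⟩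
  rw [hq, hb]
  linear_combination h6 + (-4) * h31 + 4 * h12 - 12 * h21 + (120 * m - 24) * h3 + 4 * hU

lemma pointwise (c d t t2 t3 t4 t5 e X Y : ℤ) (hc0 : 0 ≤ c) (hd0 : 0 ≤ d)
    (ht : t = 0 ∨ t = 1) (ht2 : t2 = 0 ∨ t2 = 1) (ht3 : t3 = 0 ∨ t3 = 1) (ht4 : t4 = 0 ∨ t4 = 1)
    (ht5 : t5 = 0 ∨ t5 = 1)
    (he : e = 0 ∨ (e = 1 ∧ t = 0 ∧ t2 = 0 ∧ t3 = 0 ∧ t4 = 0 ∧ t5 = 0))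
    (hc : c = t3 + 1 + t + 2 * t2 + 2 * e + 3 * X)
    (hd : d = -c + t5 - t4 - t2 + t + 2 * e - 2 + 5 * Y) :
    4 + 2 * c - (c ^ 2 - 5 * c + 4) + 5 * (t * t2)
      ≤ 3 * d + 4 * t + 3 * t2 + 7 * t3 + 3 * t4 + 12 * t5 + 12 * e := by
  by_cases h8 : 8 ≤ c
  · have h1 : 4 + 2 * c - (c ^ 2 - 5 * c + 4) ≤ -8 := by nlinarith
    have h2 : 5 * (t * t2) ≤ 4 * t + 3 * t2 := by
      rcases ht with rfl | rfl <;> rcases ht2 with rfl | rfl <;> norm_num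
    have : 0 ≤ e := by omega
    have : 0 ≤ t3 := by omega
    have : 0 ≤ t4 := by omega
    have : 0 ≤ t5 := by omega
    linarith
  · push Not at h8
    rcases he with rfl | ⟨rfl, rfl, rfl, rfl, rfl, rfl⟩
    · rcases ht with rfl | rfl <;> rcases ht2 with rfl | rfl <;> rcases ht3 with rfl | rfl <;>
      interval_cases c <;> norm_num <;> omega
    · interval_cases c <;> norm_num <;> omega

end

theorem main (n m : ℕ) (hm : n = 15 * m) (hn : 3 ≤ n) {G : Type} [AddCommGroup G] [Fintype G]
    (s : Fin n → G) (hs : Function.Bijective (vl s)) : False := by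
  have cardG : (Fintype.card G : ℤ) = 2 * n ^ 2 + 1 := by
    have h1 := T_sq s hs
    have h2 : (T s * (T s * U G)).coeff 0 = ((2 * U G - 2 * T s + T (fun i => 2 • s i)
      + 2 * (n : AddMonoidAlgebra ℤ G) - 2) * U G).coeff 0 := by
      rw [← h1]; congr 2; ring
    have h3 : (2 * U G - 2 * T s + T (fun i => 2 • s i)
      + 2 * (n : AddMonoidAlgebra ℤ G) - 2) * U G = ((2 * Fintype.card G - 2 : ℤ) : AddMonoidAlgebra ℤ G) * U G := by
      push_cast
      linear_combination 2 * U_mul_U (G := G) - 2 * T_mul_U s + T_mul_U (fun i => 2 • s i)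
    have h4 : T s * (T s * U G) = ((4 * n ^ 2 : ℤ) : AddMonoidAlgebra ℤ G) * U G := by
      push_cast
      linear_combination (T s + 2 * n) * T_mul_U s
    rw [h3, h4, ← zsmul_eq_mul, ← zsmul_eq_mul] at h2
    simp only [coeff_add, coeff_sub, coeff_neg, coeff_smul, Finsupp.add_apply, Finsupp.sub_apply,
      Finsupp.neg_apply, Finsupp.smul_apply, U_coeff, smul_eq_mul, mul_one] at h2
    linarith
  have cardN : Nat.card G = 2 * n ^ 2 + 1 := by
    rw [Nat.card_eq_fintype_card]; exact_mod_cast cardG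
  have bij : ∀ k : ℕ, Nat.Coprime (2 * n ^ 2 + 1) k → Function.Bijective (fun g : G => k • g) := by
    intro k hk
    exact (nsmulCoprime (by rw [cardN]; exact hk) : G ≃ G).bijective
  have b2 : Function.Bijective (fun g : G => 2 • g) := bij 2 (by
    rw [Nat.coprime_comm, Nat.Prime.coprime_iff_not_dvd (by norm_num)]; omega)
  have b3 : Function.Bijective (fun g : G => 3 • g) := bij 3 (by
    rw [Nat.coprime_comm, Nat.Prime.coprime_iff_not_dvd (by norm_num), hm,
      show 2 * (15 * m) ^ 2 + 1 = 3 * (150 * m ^ 2) + 1 by ring]; omega)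
  have b5 : Function.Bijective (fun g : G => 5 • g) := bij 5 (by
    rw [Nat.coprime_comm, Nat.Prime.coprime_iff_not_dvd (by norm_num), hm,
      show 2 * (15 * m) ^ 2 + 1 = 5 * (90 * m ^ 2) + 1 by ring]; omega)
  have g2 := good_smul 2 b2 s hs
  have g4 := good_smul 2 b2 _ g2
  have g3 := good_smul 3 b3 s hs
  have g5 := good_smul 5 b5 s hs
  have q1 := T_sq s hs
  have q2 := T_sq _ g2
  obtain ⟨r3, f3⟩ := T_frob 3 (by norm_num) s
  obtain ⟨r5, f5⟩ := T_frob 5 (by norm_num) s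
  have u1 := T_mul_U s
  have u2 := T_mul_U (fun i => 2 • s i)
  have u3 := T_mul_U (fun i => 3 • s i)
  have u4 := T_mul_U (fun i => 2 • 2 • s i)
  have u5 := T_mul_U (fun i => 5 • s i)
  have y1 := T_symm s
  have y2 := T_symm (fun i => 2 • s i)
  have y4 := T_symm (fun i => 2 • 2 • s i)
  have z1 := T_zero s hs
  have z2 := T_zero _ g2
  have z3 := T_zero _ g3
  have z4 := T_zero _ g4
  have z5 := T_zero _ g5
  have o1 := T_01 s hs
  have o2 := T_01 _ g2
  have o3 := T_01 _ g3
  have o4 := T_01 _ g4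
  have o5 := T_01 _ g5
  have p1 := T_nonneg s
  have p2 := T_nonneg (fun i => 2 • s i)
  have p4 := T_nonneg (fun i => 2 • 2 • s i)
  have dbl : ∑ g, (T (fun i => 2 • s i)).coeff g * (T (fun i => 2 • 2 • s i)).coeff g
      = ∑ g, (T s).coeff g * (T (fun i => 2 • s i)).coeff g := by
    rw [← b2.sum_comp]
    refine Finset.sum_congr rfl fun g _ => ?_
    rw [T_dbl 2 b2.1 s g, T_dbl 2 b2.1 (fun i => 2 • s i) g]
  have uu : U G * U G = (2 * (n : AddMonoidAlgebra ℤ G) ^ 2 + 1) * U G := by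
    rw [U_mul_U]
    congr 1
    have := congrArg (Int.cast : ℤ → AddMonoidAlgebra ℤ G) cardG
    push_cast at this
    exact this
  have hmR : (n : AddMonoidAlgebra ℤ G) = 15 * (m : AddMonoidAlgebra ℤ G) := by
    rw [hm]; push_cast; ring
  generalize T s = a at *
  generalize T (fun i => 2 • s i) = b at *
  generalize T (fun i => 2 • 2 • s i) = q at *
  generalize T (fun i => 3 • s i) = A3 at *
  generalize T (fun i => 5 • s i) = A5 at *
  obtain ⟨X, hX⟩ := ring3 hmR q1 u1 f3
  obtain ⟨Y, hY⟩ := ring5 hmR q1 q2 u1 uu f5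
  -- coefficient extraction
  have cX : ∀ g, (a * b).coeff g = A3.coeff g + 1 + a.coeff g + 2 * b.coeff g
      + 2 * (1 : AddMonoidAlgebra ℤ G).coeff g + 3 * X.coeff g := by
    intro g
    have h : a * b = A3 + U G + a + (2 : ℤ) • b + (2 : ℤ) • 1 + (3 : ℤ) • X := by
      rw [hX]; simp only [zsmul_eq_mul]; push_cast; ring
    rw [h]
    simp only [coeff_add, coeff_sub, coeff_neg, coeff_smul, Finsupp.add_apply, Finsupp.sub_apply,
      Finsupp.neg_apply, Finsupp.smul_apply, U_coeff, smul_eq_mul, mul_one]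
  have cY : ∀ g, (a * q).coeff g = - (a * b).coeff g + A5.coeff g - q.coeff g - b.coeff g
      + a.coeff g + 2 * (1 : AddMonoidAlgebra ℤ G).coeff g - 2 + 5 * Y.coeff g := by
    intro g
    have h : a * q = - (a * b) + A5 - q - b + a + (2 : ℤ) • 1 - (2 : ℤ) • U G + (5 : ℤ) • Y := by
      rw [hY]; simp only [zsmul_eq_mul]; push_cast; ring
    rw [h]
    simp only [coeff_add, coeff_sub, coeff_neg, coeff_smul, Finsupp.add_apply, Finsupp.sub_apply,
      Finsupp.neg_apply, Finsupp.smul_apply, U_coeff, smul_eq_mul, mul_one]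
  have e01 : ∀ g, (1 : AddMonoidAlgebra ℤ G).coeff g = 0 ∨ ((1 : AddMonoidAlgebra ℤ G).coeff g = 1 ∧
      a.coeff g = 0 ∧ b.coeff g = 0 ∧ A3.coeff g = 0 ∧ q.coeff g = 0 ∧ A5.coeff g = 0) := by
    intro g
    by_cases hg : g = 0
    · right
      subst hg
      exact ⟨by simp [one_def], z1, z2, z3, z4, z5⟩
    · left
      simp [one_def, Ne.symm hg]
  have key : ∀ g, _ := fun g => pointwise _ _ _ _ _ _ _ _ _ _
    (mul_nonneg' a b p1 p2 g) (mul_nonneg' a q p1 p4 g) (o1 g) (o2 g) (o3 g) (o4 g) (o5 g) (e01 g)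
    (cX g) (cY g)
  have tot := Finset.sum_le_sum (s := Finset.univ) (fun g _ => key g)
  simp only [Finset.sum_add_distrib, Finset.sum_sub_distrib, ← Finset.mul_sum, Finset.sum_const,
    Finset.card_univ] at tot
  have U0 : ∀ (k : ℤ), (k • U G).coeff 0 = k := by 
    intro k
    simp only [coeff_add, coeff_sub, coeff_neg, coeff_smul, Finsupp.add_apply, Finsupp.sub_apply,
      Finsupp.neg_apply, Finsupp.smul_apply, U_coeff, smul_eq_mul, mul_one]
  have sT : ∀ A : AddMonoidAlgebra ℤ G, A * U G = 2 * (n : AddMonoidAlgebra ℤ G) * U G →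
      ∑ g, A.coeff g = 2 * n := by
    intro A hA
    rw [sum_coeff, hA, show 2 * (n : AddMonoidAlgebra ℤ G) * U G = (2 * n : ℤ) • U G by
      rw [zsmul_eq_mul]; push_cast; ring, U0]
  have sTT : ∀ A B : AddMonoidAlgebra ℤ G, A * U G = 2 * (n : AddMonoidAlgebra ℤ G) * U G →
      B * U G = 2 * (n : AddMonoidAlgebra ℤ G) * U G → 
      ∑ g, (A * B).coeff g = 4 * n ^ 2 := by
    intro A B hA hB
    rw [sum_coeff, show A * B * U G = (4 * n ^ 2 : ℤ) • U G by
      rw [zsmul_eq_mul]; push_cast; linear_combination A * hB + 2 * n * hA, U0]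
  have s1 : ∑ g, (1 : AddMonoidAlgebra ℤ G).coeff g = 1 := by
    rw [sum_coeff, one_mul, U_coeff]
  have ab0 : (a * b).coeff 0 = ∑ g, a.coeff g * b.coeff g := (sum_prod_coeff a b y2).symm
  have bq0 : (b * q).coeff 0 = ∑ g, a.coeff g * b.coeff g := by
    rw [← dbl]; exact (sum_prod_coeff b q y4).symm
  have aq0 : 0 ≤ (a * q).coeff 0 := mul_nonneg' a q p1 p4 0
  have sq : ∑ g, (a * b).coeff g ^ 2 = 12 * n ^ 2 - 12 * n
      + 5 * ∑ g, a.coeff g * b.coeff g - 2 * (a * q).coeff 0 := by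
    simp only [sq]
    rw [sum_prod_coeff _ _ (mul_symm a b y1 y2)]
    have h : a * b * (a * b) = (8 * n ^ 2 - 8 : ℤ) • U G + (4 : ℤ) • (a * b) - (2 : ℤ) • (a * q)
        + b * q + (-4 * n + 4 : ℤ) • a + (6 - 2 * n : ℤ) • b + (2 * n - 4 : ℤ) • q
        + (4 * n ^ 2 - 12 * n + 8 : ℤ) • 1 := by
      simp only [zsmul_eq_mul]
      push_cast
      linear_combination b ^ 2 * q1 + (2 * U G - 2 * a + b + 2 * (n : AddMonoidAlgebra ℤ G) - 2) * q2
        + 4 * uu - 4 * u1 - 2 * u2 + 2 * u4 - 2 * q2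
    have one0 : (1 : AddMonoidAlgebra ℤ G).coeff 0 = 1 := by simp [one_def]
    rw [h]
    simp only [coeff_add, coeff_sub, coeff_smul, Finsupp.add_apply, Finsupp.sub_apply,
      Finsupp.smul_apply, U_coeff, z1, z2, z4, ab0, bq0, one0, smul_eq_mul]
    ring
  rw [sT a u1, sT b u2, sT A3 u3, sT q u4, sT A5 u5, s1, sTT a b u1 u2, sTT a q u1 u4, sq] at tot
  simp only [nsmul_eq_mul, cardG] at tot
  have : (15 : ℤ) ≤ n := by omega
  nlinarith

end ETile
set_option linter.unusedSimpArgs false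

namespace ETile
lemma vl_mem (n : ℕ) (x : Idx n) :
    vl (fun i => (Pi.single i 1 : Fin n → ℤ)) x ∈ errBall n := by
  rcases x with _ | ⟨i, b⟩ | ⟨⟨⟨i, j⟩, hij⟩, b, b'⟩
  · simp [vl, errBall]
  · refine ⟨fun k => ?_, ?_⟩
    · by_cases hk : k = i <;> cases b <;> simp [vl, sg, hk]
    · refine le_trans (Finset.card_le_card (t := {i}) ?_) (by simp)
      intro k hk
      simp only [Finset.mem_filter, Finset.mem_univ, true_and] at hk
      by_contra h
      apply hk
      simp only [Finset.mem_singleton] at h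
      simp [vl, h]
  · have hne : i ≠ j := ne_of_lt hij
    refine ⟨fun k => ?_, ?_⟩
    · by_cases hk : k = i
      · have hkj : k ≠ j := hk ▸ hne
        cases b <;> cases b' <;> simp [vl, sg, hk, hne]
      · by_cases hk' : k = j <;> cases b <;> cases b' <;> simp [vl, sg, hk', hk, hne.symm]
    · refine le_trans (Finset.card_le_card (t := {i, j}) ?_) Finset.card_le_two
      intro k hk
      simp only [Finset.mem_filter, Finset.mem_univ, true_and] at hk
      by_contra h
      apply hk
      simp only [Finset.mem_insert, Finset.mem_singleton, not_or] at h
      simp [vl, h.1, h.2]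

lemma vl_surj (n : ℕ) (v : Fin n → ℤ) (hv : v ∈ errBall n) :
    ∃ x : Idx n, vl (fun i => (Pi.single i 1 : Fin n → ℤ)) x = v := by
  obtain ⟨h1, h2⟩ := hv
  have hsg : ∀ i, v i ≠ 0 → ∃ b, sg b = v i := by
    intro i hi
    rcases h1 i with h | h | h
    · exact ⟨false, by simp [sg, h]⟩
    · exact absurd h hi
    · exact ⟨true, by simp [sg, h]⟩
  have hmem : ∀ k, k ∈ Finset.univ.filter (fun i => v i ≠ 0) ↔ v k ≠ 0 := by simp
  generalize Finset.univ.filter (fun i => v i ≠ 0) = S at h2 hmem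
  have h3 : S.card = 0 ∨ S.card = 1 ∨ S.card = 2 := by omega
  rcases h3 with h | h | h
  · rw [Finset.card_eq_zero] at h
    subst h
    refine ⟨Sum.inl (), ?_⟩
    funext k
    have := hmem k
    simp at this
    simp [vl, this]
  · obtain ⟨i, rfl⟩ := Finset.card_eq_one.1 h
    obtain ⟨b, hb⟩ := hsg i ((hmem i).1 (by simp))
    refine ⟨Sum.inr (Sum.inl (i, b)), ?_⟩
    funext k
    by_cases hk : k = i
    · subst hk; simp [vl, hb]
    · have := (hmem k).not.1 (by simpa using hk)
      simp at this
      simp [vl, hk, this]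
  · obtain ⟨i, j, hne, rfl⟩ := Finset.card_eq_two.1 h
    have main : ∀ i j : Fin n, i < j → (∀ k, k ∈ ({i, j} : Finset (Fin n)) ↔ v k ≠ 0) →
        ∃ x : Idx n, vl (fun i => (Pi.single i 1 : Fin n → ℤ)) x = v := by
      intro i j hij hmem
      obtain ⟨b, hb⟩ := hsg i ((hmem i).1 (by simp))
      obtain ⟨b', hb'⟩ := hsg j ((hmem j).1 (by simp))
      refine ⟨Sum.inr (Sum.inr (⟨(i, j), hij⟩, b, b')), ?_⟩
      have hne : i ≠ j := ne_of_lt hij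
      funext k
      by_cases hk : k = i
      · subst hk; simp [vl, hb, hne]
      · by_cases hk' : k = j
        · subst hk'; simp [vl, hb', hne.symm]
        · have := (hmem k).not.1 (by simp [hk, hk'])
          simp at this
          simp [vl, hk, hk', this]
    rcases lt_or_gt_of_ne hne with hlt | hlt
    · exact main i j hlt hmem
    · exact main j i hlt (by rw [Finset.pair_comm]; exact hmem)

lemma sg_inj {b b' : Bool} (h : sg b = sg b') : b = b' := by
  cases b <;> cases b' <;> simp [sg] at h ⊢

lemma sg_ne (b : Bool) : sg b ≠ 0 := by cases b <;> simp [sg]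

lemma vl_inj (n : ℕ) :
    Function.Injective (vl (fun i => (Pi.single i 1 : Fin n → ℤ))) := by
  have e1 : ∀ (i : Fin n) (b : Bool) (k : Fin n),
      vl (fun i => (Pi.single i 1 : Fin n → ℤ)) (Sum.inr (Sum.inl (i, b))) k
        = if k = i then sg b else 0 := by
    intro i b k; simp [vl, Pi.single_apply]
  have e2 : ∀ (i j : Fin n) (hij : i < j) (b b' : Bool) (k : Fin n),
      vl (fun i => (Pi.single i 1 : Fin n → ℤ)) (Sum.inr (Sum.inr (⟨(i, j), hij⟩, b, b'))) k
        = if k = i then sg b else if k = j then sg b' else 0 := by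
    intro i j hij b b' k
    have hne : i ≠ j := ne_of_lt hij
    by_cases hk : k = i
    · subst hk; simp [vl, hne]
    · simp [vl, Pi.single_apply, hk]
  have e0 : ∀ k, vl (fun i => (Pi.single i 1 : Fin n → ℤ)) (Sum.inl ()) k = 0 := by
    intro k; simp [vl]
  intro x y hxy
  have H := congrFun hxy
  rcases x with ⟨⟩ | ⟨i, b⟩ | ⟨⟨⟨i, j⟩, hij⟩, b, b'⟩ <;>
    rcases y with ⟨⟩ | ⟨p, c⟩ | ⟨⟨⟨p, q⟩, hpq⟩, c, c'⟩ <;>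
    simp only [e0, e1, e2] at H
  · rfl
  · have := H p; have := sg_ne c; grind
  · have := H p; have := sg_ne c; grind
  · have := H i; have := sg_ne b; grind
  · have h1 := H i; have := sg_ne b
    have : i = p := by grind
    subst this
    have : b = c := sg_inj (by grind)
    subst this; rfl
  · have := H p; have := H q; have := sg_ne c; have := sg_ne c'; have := ne_of_lt hpq; grind
  · have := H i; have := sg_ne b; grind
  · have := H i; have := H j; have := sg_ne b; have := sg_ne b'; have := ne_of_lt hij; grind
  · have h1 := H i; have h2 := H j; have h3 := H p; have h4 := H q
    have n1 := sg_ne b; have n2 := sg_ne b'; have n3 := sg_ne c; have n4 := sg_ne c'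
    have l1 := ne_of_lt hij; have l2 := ne_of_lt hpq
    have d1 : i = p ∨ i = q := by grind
    have d2 : j = p ∨ j = q := by grind
    have : i = p := by
      rcases d1 with d | d
      · exact d
      · rcases d2 with d' | d'
        · subst d; subst d'; exact absurd hij (not_lt_of_gt hpq)
        · exact absurd (d.trans d'.symm) l1
    subst this
    have : j = q := by
      rcases d2 with d | d
      · exact absurd d.symm l1
      · exact d
    subst this
    have : b = c := sg_inj (by grind)
    subst this
    have : b' = c' := sg_inj (by grind)
    subst this; rfl

end ETile

theorem stmt16 (n : ℕ) (hn : 3 ≤ n) (hmod : n % 15 = 0) :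
    ¬ ∃ L : AddSubgroup (Fin n → ℤ), IsLatticeTiling n (errBall n) L := by
  rintro ⟨L, hL⟩
  have hb : Function.Bijective (ETile.vl (fun i =>
      (QuotientAddGroup.mk' L) (Pi.single i 1 : Fin n → ℤ))) := by
    constructor
    · intro x y hxy
      rw [ETile.vl_map, ETile.vl_map] at hxy
      apply ETile.vl_inj n
      have h1 : -(ETile.vl (fun i => (Pi.single i 1 : Fin n → ℤ)) x)
          + ETile.vl (fun i => (Pi.single i 1 : Fin n → ℤ)) y ∈ L := QuotientAddGroup.eq.1 hxy
      have hx := ETile.vl_mem n x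
      have hy := ETile.vl_mem n y
      generalize ETile.vl (fun i => (Pi.single i 1 : Fin n → ℤ)) x = v at *
      generalize ETile.vl (fun i => (Pi.single i 1 : Fin n → ℤ)) y = w at *
      have h2 := (hL w).unique (y₁ := (v, -v + w)) (y₂ := (w, 0))
        ⟨hx, h1, by simp⟩ ⟨hy, L.zero_mem, by simp⟩
      exact congrArg Prod.fst h2
    · intro g
      obtain ⟨z, rfl⟩ := QuotientAddGroup.mk'_surjective L g
      obtain ⟨⟨v, l⟩, ⟨hv, hl, hz⟩, -⟩ := hL z
      obtain ⟨x, hx⟩ := ETile.vl_surj n v hv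
      refine ⟨x, ?_⟩
      rw [ETile.vl_map, hx]
      refine QuotientAddGroup.eq.2 ?_
      simp only at hz
      rw [hz]
      simpa using hl
  have : Finite ((Fin n → ℤ) ⧸ L) := Finite.of_surjective _ hb.2
  have := Fintype.ofFinite ((Fin n → ℤ) ⧸ L)
  exact ETile.main n (n / 15) (by omega) hn _ hb
end

section
/- Let n ≥ 3 be an integer with n ≡ 12 (mod 15). Then there is no lattice tiling of ℤⁿ by the error ball B(n,2,1,1). -/
set_option linter.all false
noncomputable def eE (R : Type) [CommRing R] {G : Type} [AddCommGroup G] (x : G) :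
    AddMonoidAlgebra R G := AddMonoidAlgebra.single x 1

noncomputable def tT (R : Type) [CommRing R] {G : Type} [AddCommGroup G] {n : ℕ} (g : Fin n → G)
    (k : ℕ) : AddMonoidAlgebra R G :=
  1 + ∑ i, (eE R (k • g i) + eE R (-(k • g i)))

noncomputable def gS (R : Type) [CommRing R] (G : Type) [AddCommGroup G] [Fintype G] :
    AddMonoidAlgebra R G := ∑ x : G, eE R x

section
variable {R : Type} [CommRing R] {G : Type} [AddCommGroup G] {n : ℕ} (g : Fin n → G)

lemma eE_mul (x y : G) : eE R x * eE R y = eE R (x + y) := by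
  simp [eE]

lemma eE_zero : eE R (0 : G) = 1 := rfl

lemma eE_pow (x : G) (k : ℕ) : eE R x ^ k = eE R (k • x) := by
  simp [eE, AddMonoidAlgebra.single_pow]

lemma coeff_int_mul (z : ℤ) (x : AddMonoidAlgebra R G) (a : G) :
    ((z : AddMonoidAlgebra R G) * x).coeff a = z * x.coeff a := by
  rw [← zsmul_eq_mul, ← zsmul_eq_mul]
  have := map_zsmul (AddMonoidAlgebra.coeffAddEquiv (R := R) (M := G)) z x
  simp only [AddMonoidAlgebra.coeffAddEquiv_apply] at this
  rw [this]; rfl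

variable [Fintype G]

lemma gS_coeff (a : G) : (gS R G).coeff a = 1 := by
  classical
  simp [gS, eE, Finsupp.single_apply]

lemma eE_mul_gS (x : G) : eE R x * gS R G = gS R G := by
  simp only [gS, Finset.mul_sum, eE_mul]
  exact Equiv.sum_comp (Equiv.addLeft x) (fun y => eE R y)

lemma tT_mul_gS (k : ℕ) : tT R g k * gS R G = ((2 * n + 1 : ℤ) : AddMonoidAlgebra R G) * gS R G := by
  simp only [tT, add_mul, Finset.sum_mul, eE_mul_gS]
  simp
  ring

lemma gS_mul_gS : gS R G * gS R G = ((Fintype.card G : ℤ) : AddMonoidAlgebra R G) * gS R G := by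
  conv_lhs => enter [1]; rw [gS]
  simp only [Finset.sum_mul, eE_mul_gS]
  simp

lemma coeff_zero_mul (x y : AddMonoidAlgebra R G) (hy : ∀ a, y.coeff (-a) = y.coeff a) :
    (x * y).coeff 0 = ∑ a, x.coeff a * y.coeff a := by
  classical
  rw [AddMonoidAlgebra.coeff_mul_antidiag x y 0
    (Finset.univ.image (fun a : G => ((a, -a) : G × G)))]
  · rw [Finset.sum_image]
    · simp [hy]
    · intro a _ b _ h; simpa using h
  · rintro ⟨a, b⟩
    simp only [Finset.mem_image, Finset.mem_univ, true_and, Prod.mk.injEq, exists_eq_left]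
    constructor
    · rintro rfl; simp
    · intro h; exact (eq_neg_of_add_eq_zero_right h).symm
lemma tT_map {f : G →+ G} (k l : ℕ) (hf : ∀ x, f x = l • x) :
    AddMonoidAlgebra.mapDomainRingHom R f (tT R g k) = tT R g (l * k) := by
  simp only [tT, eE, map_add, map_one, map_sum]
  simp [hf, mul_smul]

lemma gS_map {f : G →+ G} (hf : Function.Bijective f) :
    AddMonoidAlgebra.mapDomainRingHom R f (gS R G) = gS R G := by
  simp only [gS, eE, map_sum]
  simp only [AddMonoidAlgebra.mapDomainRingHom_apply, AddMonoidAlgebra.mapDomain_single]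
  exact (Equiv.ofBijective f hf).sum_comp (fun y => eE R y)

lemma coeff_map {f : G →+ G} (hf : Function.Injective f) (x : AddMonoidAlgebra R G) (a : G) :
    (AddMonoidAlgebra.mapDomainRingHom R f x).coeff (f a) = x.coeff a := by
  simp [AddMonoidAlgebra.mapDomainRingHom_apply, AddMonoidAlgebra.mapDomain,
    Finsupp.mapDomain_apply hf]

lemma tT_symm (k : ℕ) :
    AddMonoidAlgebra.mapDomainRingHom R (-AddMonoidHom.id G) (tT R g k) = tT R g k := by
  simp only [tT, eE, map_add, map_one, map_sum]
  simp [add_comm]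

lemma symm_coeff (x : AddMonoidAlgebra R G)
    (h : AddMonoidAlgebra.mapDomainRingHom R (-AddMonoidHom.id G) x = x) (a : G) :
    x.coeff (-a) = x.coeff a := by
  conv_lhs => rw [← h]
  exact coeff_map (f := -AddMonoidHom.id G) (by intro a b; simp) x a

lemma tT_cast (k : ℕ) :
    AddMonoidAlgebra.mapRingHom G (Int.castRingHom R) (tT ℤ g k) = tT R g k := by
  simp [tT, eE]

lemma tT_frob (p : ℕ) [Fact p.Prime] : tT (ZMod p) g 1 ^ p = tT (ZMod p) g p := by
  have : CharP (AddMonoidAlgebra (ZMod p) G) p :=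
    charP_of_injective_ringHom (RingHom.injective (algebraMap (ZMod p) (AddMonoidAlgebra (ZMod p) G))) p
  simp only [tT, add_pow_char, sum_pow_char, one_pow, eE_pow, one_smul, smul_neg]

lemma tT_nonneg (k : ℕ) (a : G) : 0 ≤ (tT ℤ g k).coeff a := by
  classical
  simp only [tT, eE, AddMonoidAlgebra.one_def, AddMonoidAlgebra.coeff_add, AddMonoidAlgebra.coeff_sum, AddMonoidAlgebra.coeff_single, Finsupp.add_apply, Finsupp.finsetSum_apply, Finsupp.single_apply]
  refine add_nonneg (by split_ifs <;> simp) (Finset.sum_nonneg fun i _ => add_nonneg ?_ ?_) <;> split_ifs <;> simp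

lemma tT_sq (hb : gS R G = 1 + ∑ i, (eE R (g i) + eE R (-g i)) +
      ∑ i, ∑ j, if i < j then (eE R (g i) + eE R (-g i)) * (eE R (g j) + eE R (-g j)) else 0) :
    tT R g 1 ^ 2 = tT R g 2 + 2 * gS R G + ((2 * n - 2 : ℤ) : AddMonoidAlgebra R G) := by
  set a : Fin n → AddMonoidAlgebra R G := fun i => eE R (g i) + eE R (-g i) with ha
  have h1 : tT R g 1 = 1 + ∑ i, a i := by simp [tT, ha]
  have h2 : tT R g 2 = 1 + ∑ i, (a i ^ 2 - 2) := by
    rw [tT]; congr 1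
    refine Finset.sum_congr rfl fun i _ => ?_
    have : eE R (g i) * eE R (-g i) = 1 := by rw [eE_mul, add_neg_cancel, eE_zero]
    rw [← smul_neg, ← eE_pow, ← eE_pow]
    simp only [ha]
    linear_combination (-2) * this
  have h3 : (∑ i, a i) ^ 2 = ∑ i, a i ^ 2 + 2 * ∑ i, ∑ j, if i < j then a i * a j else 0 := by
    rw [sq, Finset.sum_mul_sum]
    have : ∀ i j, a i * a j = (if i < j then a i * a j else 0) + (if j < i then a j * a i else 0)
        + (if i = j then a i ^ 2 else 0) := by
      intro i j
      rcases lt_trichotomy i j with h | h | h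
      · simp [h, h.ne, h.not_gt]
      · subst h; simp [sq]
      · simp [h, h.ne', h.not_gt, mul_comm]
    conv_lhs => enter [2, i, 2, j]; rw [this i j]
    simp only [Finset.sum_add_distrib]
    rw [Finset.sum_comm (f := fun i j => if j < i then a j * a i else 0)]
    simp
    ring
  rw [h1, h2, Finset.sum_sub_distrib]
  simp
  linear_combination h3 - 2 * hb
lemma coeff_eE_ne {x : G} (h : x ≠ 0) : (eE R x).coeff 0 = 0 := by
  classical
  simp [eE, Finsupp.single_apply, h]

lemma tT_coeff_zero (k : ℕ) (h : ∀ i, k • g i ≠ 0) : (tT R g k).coeff 0 = 1 := by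
  have : ∀ i, -(k • g i) ≠ 0 := fun i => neg_ne_zero.2 (h i)
  simp [tT, coeff_eE_ne, h, this]

lemma tT_one_two (h0 : ∀ i, g i ≠ 0) (h2 : ∀ i, 2 • g i ≠ 0) (h3 : ∀ i, 3 • g i ≠ 0)
    (hne : ∀ i j, i ≠ j → g i + 2 • g j ≠ 0 ∧ g i - 2 • g j ≠ 0) :
    (tT R g 1 * tT R g 2).coeff 0 = 1 := by
  have key : ∀ i j, g i + 2 • g j ≠ 0 ∧ g i - 2 • g j ≠ 0 := by
    intro i j
    by_cases h : i = j
    · subst h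
      refine ⟨fun h => h3 i ?_, fun h => h0 i ?_⟩
      · rw [← h]; abel
      · rw [← neg_eq_zero, ← h]; abel
    · exact hne i j h
  have e1 : ∀ i, -g i ≠ 0 := fun i => neg_ne_zero.2 (h0 i)
  have e2 : ∀ i, -(2 • g i) ≠ 0 := fun i => neg_ne_zero.2 (h2 i)
  have k1 : ∀ i j, g i + 2 • g j ≠ 0 := fun i j => (key i j).1
  have k2 : ∀ i j, g i + -(2 • g j) ≠ 0 := fun i j => by
    rw [← sub_eq_add_neg]; exact (key i j).2
  have k3 : ∀ i j, -g i + 2 • g j ≠ 0 := fun i j h => k2 i j (by rw [← neg_eq_zero, ← h]; abel)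
  have k4 : ∀ i j, -g i + -(2 • g j) ≠ 0 := fun i j h => k1 i j (by rw [← neg_eq_zero, ← h]; abel)
  simp only [tT, one_smul, mul_add, add_mul, one_mul, mul_one, Finset.sum_mul_sum, eE_mul]
  simp only [AddMonoidAlgebra.coeff_add, AddMonoidAlgebra.coeff_sum, Finsupp.add_apply,
    Finsupp.finsetSum_apply, AddMonoidAlgebra.coeff_one_zero]
  simp [coeff_eE_ne, h0, h2, e1, e2, k1, k2, k3, k4]

lemma point_ineq (c d t1 t3 t5 : ℤ) (h1 : 0 ≤ t1) (h3 : 0 ≤ t3) (h5 : 0 ≤ t5)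
    (hc : t1 = 0 → t3 = 0 → t5 = 0 → c % 3 = 1 ∧ (d - c) % 5 = 0) :
    0 ≤ 4 * (c ^ 2 - 5 * c + 4) + 5 * (d ^ 2 - 5 * d + 4) - 2 * (c - d) ^ 2
      + 21 * (t1 + t3 + t5) := by
  by_cases h : t1 = 0 ∧ t3 = 0 ∧ t5 = 0
  · obtain ⟨rfl, rfl, rfl⟩ := h
    obtain ⟨hc, hd⟩ := hc rfl rfl rfl
    obtain ⟨k, hk⟩ : ∃ k, c = 1 + 3 * k := ⟨c / 3, by omega⟩
    obtain ⟨m, hm⟩ : ∃ m, d = c + 5 * m := ⟨(d - c) / 5, by omega⟩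
    have q : ∀ x : ℤ, 0 ≤ x * (x - 1) := by
      intro x
      rcases le_or_gt x 0 with h | h
      · exact mul_nonneg_of_nonpos_of_nonpos h (by omega)
      · exact mul_nonneg h.le (by omega)
    have := q (k + m)
    have := q k
    subst hm; subst hk
    nlinarith
  · have : 1 ≤ t1 + t3 + t5 := by omega
    nlinarith [sq_nonneg (c + d - 5), sq_nonneg (2 * d - 5)]

theorem core_s17 (hn : n % 15 = 12) (h0 : ∀ i, g i ≠ 0)
    (hne : ∀ i j, i ≠ j → g i + 2 • g j ≠ 0 ∧ g i - 2 • g j ≠ 0)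
    (hb : ∀ (R : Type) [CommRing R], gS R G = 1 + ∑ i, (eE R (g i) + eE R (-g i)) +
      ∑ i, ∑ j, if i < j then (eE R (g i) + eE R (-g i)) * (eE R (g j) + eE R (-g j)) else 0) :
    False := by
  have sq1 : ∀ (R : Type) [CommRing R], tT R g 1 ^ 2 = tT R g 2 + 2 * gS R G +
      ((2 * n - 2 : ℤ) : AddMonoidAlgebra R G) := fun R _ => tT_sq g (hb R)
  have tg : ∀ (R : Type) [CommRing R] k, tT R g k * gS R G =
      ((2 * n + 1 : ℤ) : AddMonoidAlgebra R G) * gS R G := fun R _ k => tT_mul_gS g k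
  have cG : ∀ a, (gS ℤ G).coeff a = 1 := fun a => gS_coeff a
  -- cardinality
  have hcard : (Fintype.card G : ℤ) = 2 * n ^ 2 + 1 := by
    have e : ((4 * n ^ 2 + 2 : ℤ) : AddMonoidAlgebra ℤ G) * gS ℤ G =
        ((2 * Fintype.card G : ℤ) : AddMonoidAlgebra ℤ G) * gS ℤ G := by
      have := gS_mul_gS (R := ℤ) (G := G)
      have s1 := sq1 ℤ
      have t1 := tg ℤ 1
      have t2 := tg ℤ 2
      push_cast at *
      linear_combination gS ℤ G * s1 - (tT ℤ g 1 + (2 * n + 1)) * t1 + t2 + 2 * this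
    have := congrArg (fun x => x.coeff 0) e
    simp only [coeff_int_mul, cG] at this
    push_cast at this
    simp at this
    linarith
  have hcardn : Nat.card G = 2 * n ^ 2 + 1 := by
    rw [Nat.card_eq_fintype_card]; exact_mod_cast hcard
  have bij2 : Function.Bijective (fun x : G => 2 • x) := by
    apply Nat.Coprime.nsmul_right_bijective
    rw [hcardn]
    simp [Nat.coprime_mul_right_add_left]
  have bij3 : Function.Bijective (fun x : G => 3 • x) := by
    apply Nat.Coprime.nsmul_right_bijective
    rw [hcardn]
    obtain ⟨m, rfl⟩ : ∃ m, n = 3 * m := ⟨n / 3, by omega⟩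
    rw [show 2 * (3 * m) ^ 2 + 1 = 1 + 3 * (6 * m ^ 2) by ring]
    simp [Nat.coprime_add_mul_left_left]
  let f2 : G →+ G := nsmulAddMonoidHom 2
  have hf2 : ∀ x, f2 x = 2 • x := fun x => rfl
  have bf2 : Function.Bijective f2 := bij2
  have m2 : ∀ x : G, x ≠ 0 → 2 • x ≠ 0 := fun x hx h => hx (bij2.1 (by simpa using h))
  have m3 : ∀ x : G, x ≠ 0 → 3 • x ≠ 0 := fun x hx h => hx (bij3.1 (by simpa using h))
  have n2 : ∀ i, 2 • g i ≠ 0 := fun i => m2 _ (h0 i)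
  have n3 : ∀ i, 3 • g i ≠ 0 := fun i => m3 _ (h0 i)
  have n4 : ∀ i, 4 • g i ≠ 0 := fun i => by
    have := m2 _ (n2 i); rwa [← mul_smul] at this
  have n8 : ∀ i, 8 • g i ≠ 0 := fun i => by
    have := m2 _ (n4 i); rwa [← mul_smul] at this
  have sq2 : ∀ (R : Type) [CommRing R], tT R g 2 ^ 2 = tT R g 4 + 2 * gS R G +
      ((2 * n - 2 : ℤ) : AddMonoidAlgebra R G) := by
    intro R _
    have := congrArg (AddMonoidAlgebra.mapDomainRingHom R f2) (sq1 R)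
    simpa only [map_pow, map_add, map_mul, map_ofNat, map_intCast, gS_map bf2, tT_map g _ 2 hf2]
      using this
  have sq4 : ∀ (R : Type) [CommRing R], tT R g 4 ^ 2 = tT R g 8 + 2 * gS R G +
      ((2 * n - 2 : ℤ) : AddMonoidAlgebra R G) := by
    intro R _
    have := congrArg (AddMonoidAlgebra.mapDomainRingHom R f2) (sq2 R)
    simpa only [map_pow, map_add, map_mul, map_ofNat, map_intCast, gS_map bf2, tT_map g _ 2 hf2]
      using this
  have sy : ∀ k, ∀ a, (tT ℤ g k).coeff (-a) = (tT ℤ g k).coeff a :=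
    fun k => symm_coeff _ (tT_symm g k)
  have sy2 : ∀ k l, ∀ a, (tT ℤ g k * tT ℤ g l).coeff (-a) = (tT ℤ g k * tT ℤ g l).coeff a :=
    fun k l => symm_coeff _ (by rw [map_mul, tT_symm, tT_symm])
  have z1 : (tT ℤ g 1).coeff 0 = 1 := tT_coeff_zero g 1 (by simpa using h0)
  have z2 : (tT ℤ g 2).coeff 0 = 1 := tT_coeff_zero g 2 n2
  have z4 : (tT ℤ g 4).coeff 0 = 1 := tT_coeff_zero g 4 n4
  have z8 : (tT ℤ g 8).coeff 0 = 1 := tT_coeff_zero g 8 n8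
  have z12 : (tT ℤ g 1 * tT ℤ g 2).coeff 0 = 1 := tT_one_two g h0 n2 n3 hne
  have z24 : (tT ℤ g 2 * tT ℤ g 4).coeff 0 = 1 := by
    have := coeff_map (R := ℤ) bf2.1 (tT ℤ g 1 * tT ℤ g 2) 0
    simpa only [map_mul, tT_map g _ 2 hf2, map_zero, z12] using this
  have z28 : (tT ℤ g 2 * tT ℤ g 8).coeff 0 = (tT ℤ g 1 * tT ℤ g 4).coeff 0 := by
    have := coeff_map (R := ℤ) bf2.1 (tT ℤ g 1 * tT ℤ g 4) 0
    simpa only [map_mul, tT_map g _ 2 hf2, map_zero] using this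
  have one0 : (1 : AddMonoidAlgebra ℤ G).coeff 0 = 1 := AddMonoidAlgebra.coeff_one_zero
  have gg := gS_mul_gS (R := ℤ) (G := G)
  rw [hcard] at gg
  have s1 := sq1 ℤ
  have s2 := sq2 ℤ
  have s4 := sq4 ℤ
  have t1 := tg ℤ 1
  have t2 := tg ℤ 2
  have t4 := tg ℤ 4
  have t8 := tg ℤ 8
  set A := tT ℤ g 1 with hA
  set B := tT ℤ g 2 with hB
  set C := tT ℤ g 4 with hC
  set H := tT ℤ g 8 with hH
  set J := gS ℤ G with hJ
  set c := fun a => (A * B).coeff a with hc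
  set d := fun a => (A * C).coeff a with hd
  -- sums
  have Sc : ∑ a, c a = (2 * n + 1) ^ 2 := by
    have e : (A * B) * J = (((2 * n + 1) ^ 2 : ℤ) : AddMonoidAlgebra ℤ G) * J := by
      push_cast at *
      linear_combination A * t2 + (2 * n + 1) * t1
    have e2 := congrArg (fun x => x.coeff 0) e
    simp only [coeff_int_mul, cG] at e2
    rw [coeff_zero_mul _ _ (by simp [cG])] at e2
    simpa [cG] using e2
  have Sd : ∑ a, d a = (2 * n + 1) ^ 2 := by
    have e : (A * C) * J = (((2 * n + 1) ^ 2 : ℤ) : AddMonoidAlgebra ℤ G) * J := by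
      push_cast at *
      linear_combination A * t4 + (2 * n + 1) * t1
    have e2 := congrArg (fun x => x.coeff 0) e
    simp only [coeff_int_mul, cG] at e2
    rw [coeff_zero_mul _ _ (by simp [cG])] at e2
    simpa [cG] using e2
  have ST : ∀ k, ∑ a, (tT ℤ g k).coeff a = 2 * n + 1 := by
    intro k
    have e2 := congrArg (fun x => x.coeff 0) (tg ℤ k)
    simp only [coeff_int_mul, gS_coeff] at e2
    rw [coeff_zero_mul _ _ (by simp [gS_coeff])] at e2
    simpa [gS_coeff] using e2
  have Scc : ∑ a, c a * c a = 12 * n ^ 2 + 12 * n + 1 := by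
    have e : (A * B) * (A * B) = B * C + ((8 * n ^ 2 + 16 * n : ℤ) : AddMonoidAlgebra ℤ G) * J
        + ((2 * n - 2 : ℤ) : AddMonoidAlgebra ℤ G) * B
        + ((2 * n - 2 : ℤ) : AddMonoidAlgebra ℤ G) * C
        + (((2 * n - 2) ^ 2 : ℤ) : AddMonoidAlgebra ℤ G) * 1 := by
      push_cast at *
      linear_combination B ^ 2 * s1 + (B + 2 * J + 2 * n - 2) * s2 + 2 * t2 + 2 * t4 + 4 * gg
    have e2 := congrArg (fun x => x.coeff 0) e
    simp only [AddMonoidAlgebra.coeff_add, Finsupp.add_apply, coeff_int_mul, cG, z24, z2, z4, one0] at e2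
    rw [coeff_zero_mul _ _ (sy2 1 2)] at e2
    rw [e2]; push_cast; ring
  have Sdd : ∑ a, d a * d a = 12 * n ^ 2 + 12 * n + d 0 := by
    have e : (A * C) * (A * C) = B * H + ((8 * n ^ 2 + 16 * n : ℤ) : AddMonoidAlgebra ℤ G) * J
        + ((2 * n - 2 : ℤ) : AddMonoidAlgebra ℤ G) * B
        + ((2 * n - 2 : ℤ) : AddMonoidAlgebra ℤ G) * H
        + (((2 * n - 2) ^ 2 : ℤ) : AddMonoidAlgebra ℤ G) * 1 := by
      push_cast at *
      linear_combination C ^ 2 * s1 + (B + 2 * J + 2 * n - 2) * s4 + 2 * t2 + 2 * t8 + 4 * gg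
    have e2 := congrArg (fun x => x.coeff 0) e
    simp only [AddMonoidAlgebra.coeff_add, Finsupp.add_apply, coeff_int_mul, cG, z28, z2, z8, one0] at e2
    rw [coeff_zero_mul _ _ (sy2 1 4)] at e2
    rw [e2]; simp only [hd]; push_cast; ring
  have zCC : (C * C).coeff 0 = 2 * n + 1 := by
    have e : C * C = H + ((2 : ℤ) : AddMonoidAlgebra ℤ G) * J
        + ((2 * n - 2 : ℤ) : AddMonoidAlgebra ℤ G) * 1 := by
      push_cast at *
      linear_combination s4
    have e2 := congrArg (fun x => x.coeff 0) e
    simp only [AddMonoidAlgebra.coeff_add, Finsupp.add_apply, coeff_int_mul, cG, z8, one0] at e2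
    rw [e2]; push_cast; ring
  have zAA : (A * A).coeff 0 = 2 * n + 1 := by
    have e : A * A = B + ((2 : ℤ) : AddMonoidAlgebra ℤ G) * J
        + ((2 * n - 2 : ℤ) : AddMonoidAlgebra ℤ G) * 1 := by
      push_cast at *
      linear_combination s1
    have e2 := congrArg (fun x => x.coeff 0) e
    simp only [AddMonoidAlgebra.coeff_add, Finsupp.add_apply, coeff_int_mul, cG, z2, one0] at e2
    rw [e2]; push_cast; ring
  have Scd : ∑ a, c a * d a = 8 * n ^ 2 + 18 * n + 1 := by
    have e : (A * B) * (A * C) = C * C + ((8 * n ^ 2 + 12 * n + 4 : ℤ) : AddMonoidAlgebra ℤ G) * J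
        + ((2 * n - 2 : ℤ) : AddMonoidAlgebra ℤ G) * C
        + ((2 * n - 2 : ℤ) : AddMonoidAlgebra ℤ G) * (B * C) := by
      push_cast at *
      linear_combination B * C * s1 + C * s2 + 2 * t4 + 2 * B * t4 + 2 * (2 * n + 1) * t2
    have e2 := congrArg (fun x => x.coeff 0) e
    simp only [AddMonoidAlgebra.coeff_add, Finsupp.add_apply, coeff_int_mul, cG, z24, z4, zCC] at e2
    rw [coeff_zero_mul _ _ (sy2 1 4)] at e2
    rw [e2]; push_cast; ring
  have hd0 : d 0 ≤ 2 * n + 1 := by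
    have a1 := coeff_zero_mul A A (sy 1)
    have a2 := coeff_zero_mul C C (sy 4)
    have a3 := coeff_zero_mul A C (sy 4)
    have : 0 ≤ ∑ a, (A.coeff a - C.coeff a) ^ 2 := Finset.sum_nonneg fun a _ => sq_nonneg _
    have e : ∑ a, (A.coeff a - C.coeff a) ^ 2 = ∑ a, A.coeff a * A.coeff a
        + ∑ a, C.coeff a * C.coeff a - 2 * ∑ a, A.coeff a * C.coeff a := by
      rw [Finset.mul_sum, ← Finset.sum_add_distrib, ← Finset.sum_sub_distrib]
      exact Finset.sum_congr rfl fun a _ => by ring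
    rw [e, ← a1, ← a2, ← a3, zAA, zCC] at this
    simp only [hd]; linarith
  -- congruences
  have castc : ∀ (p : ℕ) k l a, (((tT ℤ g k * tT ℤ g l).coeff a : ℤ) : ZMod p) =
      (tT (ZMod p) g k * tT (ZMod p) g l).coeff a := by
    intro p k l a
    rw [← tT_cast (R := ZMod p) g k, ← tT_cast (R := ZMod p) g l, ← map_mul, AddMonoidAlgebra.coeff_mapRingHom]; simp
  have castt : ∀ (p : ℕ) k a, (((tT ℤ g k).coeff a : ℤ) : ZMod p) =
      (tT (ZMod p) g k).coeff a := by
    intro p k a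
    rw [← tT_cast (R := ZMod p) g k, AddMonoidAlgebra.coeff_mapRingHom]; simp
  have mod3 : ∀ a, (tT ℤ g 1).coeff a = 0 → (tT ℤ g 3).coeff a = 0 → c a % 3 = 1 := by
    intro a ha1 ha3
    have : Fact (Nat.Prime 3) := ⟨by norm_num⟩
    have fr := tT_frob g 3
    have e : tT (ZMod 3) g 1 * tT (ZMod 3) g 2 = tT (ZMod 3) g 3
        + ((-(2 * (2 * n + 1)) : ℤ) : AddMonoidAlgebra (ZMod 3) G) * gS (ZMod 3) G
        + ((-(2 * n - 2) : ℤ) : AddMonoidAlgebra (ZMod 3) G) * tT (ZMod 3) g 1 := by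
      have s1 := sq1 (ZMod 3)
      have t1 := tg (ZMod 3) 1
      push_cast at *
      linear_combination fr - tT (ZMod 3) g 1 * s1 - 2 * t1
    have e2 := congrArg (fun x => x.coeff a) e
    simp only [AddMonoidAlgebra.coeff_add, Finsupp.add_apply, coeff_int_mul, gS_coeff, ← castc,
      ← castt, ha1, ha3] at e2
    have e3 : ((c a : ℤ) : ZMod 3) = ((-(2 * (2 * n + 1)) : ℤ) : ZMod 3) := by
      simpa using e2
    rw [ZMod.intCast_eq_intCast_iff'] at e3
    push_cast at e3
    omega
  have mod5 : ∀ a, (tT ℤ g 1).coeff a = 0 → (tT ℤ g 5).coeff a = 0 → (d a - c a) % 5 = 0 := by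
    intro a ha1 ha5
    have : Fact (Nat.Prime 5) := ⟨by norm_num⟩
    have fr := tT_frob g 5
    obtain ⟨m, hm⟩ : ∃ m, n = 5 * m + 2 := ⟨n / 5, by omega⟩
    have h5 : (5 : AddMonoidAlgebra (ZMod 5) G) = 0 := by
      have : ((5 : ZMod 5)) = 0 := by
        exact_mod_cast CharP.cast_eq_zero (ZMod 5) 5
      have := congrArg (algebraMap (ZMod 5) (AddMonoidAlgebra (ZMod 5) G)) this
      simpa only [map_ofNat, map_zero] using this
    have e : tT (ZMod 5) g 1 * tT (ZMod 5) g 4 = tT (ZMod 5) g 1 * tT (ZMod 5) g 2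
        + tT (ZMod 5) g 5
        + ((-1 : ℤ) : AddMonoidAlgebra (ZMod 5) G) * tT (ZMod 5) g 1 := by
      have s1 := sq1 (ZMod 5)
      have s2 := sq2 (ZMod 5)
      have t1 := tg (ZMod 5) 1
      have k1 : ((2 * n - 2 : ℤ) : AddMonoidAlgebra (ZMod 5) G) = 2 := by
        rw [hm]; push_cast; linear_combination (2 * m : AddMonoidAlgebra (ZMod 5) G) * h5
      have k2 : ((2 * n + 1 : ℤ) : AddMonoidAlgebra (ZMod 5) G) = 0 := by
        rw [hm]; push_cast; linear_combination (2 * m + 1 : AddMonoidAlgebra (ZMod 5) G) * h5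
      rw [k1] at s1 s2
      rw [k2, zero_mul] at t1
      set a := tT (ZMod 5) g 1
      set b := tT (ZMod 5) g 2
      set q := tT (ZMod 5) g 4
      set J := gS (ZMod 5) G
      have r1 : a ^ 5 = a * (b + 2 * J + 2) ^ 2 := by
        rw [← s1]; ring
      rw [fr] at r1
      have r2 : a * (b + 2 * J + 2) ^ 2 = a * (b + 2) ^ 2 := by
        linear_combination (4 * (b + 2) + 4 * J) * t1
      push_cast
      linear_combination -r1 - r2 - a * s2 - 2 * t1 + (-a * b - a) * h5
    have e2 := congrArg (fun x => x.coeff a) e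
    simp only [AddMonoidAlgebra.coeff_add, Finsupp.add_apply, coeff_int_mul, ← castc,
      ← castt, ha1, ha5] at e2
    have e3 : ((d a : ℤ) : ZMod 5) = ((c a : ℤ) : ZMod 5) := by
      simpa using e2
    rw [ZMod.intCast_eq_intCast_iff'] at e3
    push_cast at e3
    omega
  have fin := Finset.sum_nonneg (s := Finset.univ) fun a _ => point_ineq (c a) (d a)
    ((tT ℤ g 1).coeff a) ((tT ℤ g 3).coeff a) ((tT ℤ g 5).coeff a)
    (tT_nonneg g 1 a) (tT_nonneg g 3 a) (tT_nonneg g 5 a)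
    (fun x y z => ⟨mod3 a x y, mod5 a x z⟩)
  have efin : ∑ a, (4 * (c a ^ 2 - 5 * c a + 4) + 5 * (d a ^ 2 - 5 * d a + 4)
      - 2 * (c a - d a) ^ 2
      + 21 * ((tT ℤ g 1).coeff a + (tT ℤ g 3).coeff a + (tT ℤ g 5).coeff a))
      = 2 * ∑ a, c a * c a + 3 * ∑ a, d a * d a + 4 * ∑ a, c a * d a - 20 * ∑ a, c a
        - 25 * ∑ a, d a + 36 * Fintype.card G
        + 21 * (∑ a, (tT ℤ g 1).coeff a + ∑ a, (tT ℤ g 3).coeff a + ∑ a, (tT ℤ g 5).coeff a) := by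
    have : (36 * Fintype.card G : ℤ) = ∑ a : G, 36 := by simp [mul_comm]
    rw [this]
    simp only [Finset.mul_sum, mul_add, ← Finset.sum_add_distrib, ← Finset.sum_sub_distrib]
    exact Finset.sum_congr rfl fun a _ => by ring
  rw [efin, Scc, Sdd, Scd, Sc, Sd, ST, ST, ST, hcard] at fin
  have : 12 ≤ (n : ℤ) := by omega
  nlinarith
end

-- parametrization of the ball
abbrev bIdx (n : ℕ) : Type :=
  Unit ⊕ (Fin n × Bool) ⊕ ({p : Fin n × Fin n // p.1 < p.2} × Bool × Bool)

def sgn (b : Bool) : ℤ := if b then 1 else -1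

def bVec (n : ℕ) : bIdx n → (Fin n → ℤ)
  | .inl _ => 0
  | .inr (.inl (i, s)) => Pi.single i (sgn s)
  | .inr (.inr (p, s, t)) => Pi.single p.1.1 (sgn s) + Pi.single p.1.2 (sgn t)

lemma sgn_cases (b : Bool) : sgn b = 1 ∨ sgn b = -1 := by cases b <;> simp [sgn]
lemma sgn_inj {a b : Bool} (h : sgn a = sgn b) : a = b := by
  cases a <;> cases b <;> simp [sgn] at h ⊢
lemma exists_sgn {z : ℤ} (h : z = -1 ∨ z = 0 ∨ z = 1) (h0 : z ≠ 0) : ∃ b, sgn b = z := by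
  rcases h with h | h | h
  · exact ⟨false, by simp [sgn, h]⟩
  · exact absurd h h0
  · exact ⟨true, by simp [sgn, h]⟩

lemma pair_mem {n : ℕ} {i j : Fin n} (hij : i ≠ j) {s t : ℤ} (hs : s = 1 ∨ s = -1)
    (ht : t = 1 ∨ t = -1) : (Pi.single i s + Pi.single j t : Fin n → ℤ) ∈ errBall n := by
  refine ⟨fun k => ?_, ?_⟩
  · simp only [Pi.add_apply, Pi.single_apply]
    split_ifs <;> grind
  · refine (Finset.card_le_card (t := {i, j}) ?_).trans Finset.card_le_two
    intro k hk
    simp only [Finset.mem_filter, Finset.mem_univ, true_and, Pi.add_apply, Pi.single_apply] at hk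
    simp only [Finset.mem_insert, Finset.mem_singleton]
    by_contra h
    push Not at h
    simp [h.1, h.2] at hk

lemma single_mem {n : ℕ} (i : Fin n) {s : ℤ} (hs : s = 1 ∨ s = -1) :
    (Pi.single i s : Fin n → ℤ) ∈ errBall n := by
  refine ⟨fun k => ?_, ?_⟩
  · simp only [Pi.single_apply]
    split_ifs <;> grind
  · refine (Finset.card_le_card (t := {i, i}) ?_).trans Finset.card_le_two
    intro k hk
    simp only [Finset.mem_filter, Finset.mem_univ, true_and, Pi.single_apply] at hk
    simp only [Finset.mem_insert, Finset.mem_singleton]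
    by_contra h
    push Not at h
    simp [h.1] at hk

lemma zero_mem_ball (n : ℕ) : (0 : Fin n → ℤ) ∈ errBall n := by
  refine ⟨fun k => by simp, by simp⟩

lemma bVec_mem {n : ℕ} (b : bIdx n) : bVec n b ∈ errBall n := by
  rcases b with _ | ⟨i, s⟩ | ⟨⟨⟨i, j⟩, h⟩, s, t⟩
  · exact zero_mem_ball n
  · exact single_mem i (sgn_cases s)
  · exact pair_mem (ne_of_lt h) (sgn_cases s) (sgn_cases t)

lemma bVec_surj {n : ℕ} {v : Fin n → ℤ} (hv : v ∈ errBall n) : ∃ b, bVec n b = v := by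
  obtain ⟨h1, h2⟩ := hv
  have key : ∀ k, k ∉ Finset.univ.filter (fun i => v i ≠ 0) → v k = 0 := by
    intro k hk; simpa using hk
  have key' : ∀ k, k ∈ Finset.univ.filter (fun i => v i ≠ 0) → v k ≠ 0 := by
    intro k hk; simpa using hk
  generalize Finset.univ.filter (fun i => v i ≠ 0) = S at *
  have h3 : S.card = 0 ∨ S.card = 1 ∨ S.card = 2 := by omega
  rcases h3 with h | h | h
  · rw [Finset.card_eq_zero] at h
    subst h
    exact ⟨.inl (), funext fun k => by simp [bVec, key k]⟩
  · obtain ⟨i, rfl⟩ := Finset.card_eq_one.1 h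
    obtain ⟨s, hs⟩ := exists_sgn (h1 i) (key' i (by simp))
    refine ⟨.inr (.inl (i, s)), funext fun k => ?_⟩
    by_cases hk : k = i
    · subst hk; simp [bVec, hs]
    · simp [bVec, hk, key k (by simpa using hk)]
  · obtain ⟨i, j, hij, rfl⟩ := Finset.card_eq_two.1 h
    wlog hlt : i < j generalizing i j
    · have hlt' : j < i := lt_of_le_of_ne (not_lt.1 hlt) hij.symm
      have hS : ({i, j} : Finset (Fin n)) = {j, i} := Finset.pair_comm i j
      rw [hS] at h2 key key' h
      exact this j i hij.symm h2 key key' h hlt'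
    obtain ⟨s, hs⟩ := exists_sgn (h1 i) (key' i (by simp))
    obtain ⟨t, ht⟩ := exists_sgn (h1 j) (key' j (by simp))
    refine ⟨.inr (.inr (⟨(i, j), hlt⟩, s, t)), funext fun k => ?_⟩
    by_cases hk : k = i
    · subst hk; simp [bVec, hs, hij]
    · by_cases hk' : k = j
      · subst hk'; simp [bVec, ht, hij.symm]
      · simp [bVec, hk, hk', key k (by simp [hk, hk'])]

lemma sgn_ne (b : Bool) : sgn b ≠ 0 := by cases b <;> simp [sgn]

lemma bVec_inj {n : ℕ} : Function.Injective (bVec n) := by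
  intro b b' h
  have H : ∀ k, bVec n b k = bVec n b' k := fun k => congrFun h k
  rcases b with _ | ⟨i, s⟩ | ⟨⟨⟨i, j⟩, hij⟩, s, t⟩ <;>
  rcases b' with _ | ⟨i', s'⟩ | ⟨⟨⟨i', j'⟩, hij'⟩, s', t'⟩ <;>
  simp only [bVec, Pi.add_apply, Pi.single_apply, Pi.zero_apply] at H
  · rfl
  · have := H i'; have := sgn_ne s'; grind
  · have := H i'; have := sgn_ne s'; grind
  · have := H i; have := sgn_ne s; grind
  · have a1 := H i; have := sgn_ne s; have := sgn_ne s'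
    have : i = i' := by grind
    subst this
    have : s = s' := sgn_inj (by simpa using a1)
    subst this; rfl
  · have := H i'; have := H j'; have := sgn_ne s'; have := sgn_ne t'; grind
  · have := H i; have := sgn_ne s; grind
  · have := H i; have := H j; have := sgn_ne s; have := sgn_ne t; grind
  · have a1 := H i; have a2 := H j; have a3 := H i'; have a4 := H j'
    have := sgn_ne s; have := sgn_ne s'; have := sgn_ne t; have := sgn_ne t'
    simp only at hij hij'
    have e1 : i = i' := by grind
    have e2 : j = j' := by grind
    subst e1; subst e2
    have e3 : s = s' := sgn_inj (by grind)
    have e4 : t = t' := sgn_inj (by grind)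
    subst e3; subst e4; rfl

theorem stmt17 (n : ℕ) (hn : 3 ≤ n) (hmod : n % 15 = 12) :
    ¬ ∃ L : AddSubgroup (Fin n → ℤ), IsLatticeTiling n (errBall n) L := by
  rintro ⟨L, hL⟩
  let G := (Fin n → ℤ) ⧸ L
  let φ : (Fin n → ℤ) →+ G := QuotientAddGroup.mk' L
  have inj : ∀ v ∈ errBall n, ∀ w ∈ errBall n, φ v = φ w → v = w := by
    intro v hv w hw h
    have hm : -w + v ∈ L := QuotientAddGroup.eq.1 h.symm
    have := (hL v).unique (y₁ := (v, 0)) (y₂ := (w, -w + v))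
      ⟨hv, L.zero_mem, by simp⟩ ⟨hw, hm, by simp⟩
    exact (Prod.mk.inj this).1
  have bij : Function.Bijective (fun b => φ (bVec n b)) := by
    constructor
    · intro b b' h
      exact bVec_inj (inj _ (bVec_mem b) _ (bVec_mem b') h)
    · intro x
      obtain ⟨y, rfl⟩ := QuotientAddGroup.mk'_surjective L x
      obtain ⟨⟨v, l⟩, ⟨hv, hl, hx⟩, -⟩ := hL y
      obtain ⟨b, rfl⟩ := bVec_surj hv
      refine ⟨b, QuotientAddGroup.eq.2 ?_⟩
      simp only at hx hl
      rw [hx]; simpa using hl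
  let eq := Equiv.ofBijective _ bij
  letI : Fintype G := Fintype.ofEquiv _ eq
  let g : Fin n → G := fun i => φ (Pi.single i 1)
  have hg1 : ∀ i, φ (Pi.single i (sgn true)) = g i := fun i => rfl
  have hg2 : ∀ i, φ (Pi.single i (sgn false)) = -g i := fun i => by
    rw [← map_neg, ← Pi.single_neg]; rfl
  refine core_s17 g hmod ?_ ?_ ?_
  · intro i h
    have := inj _ (single_mem i (Or.inl rfl)) _ (zero_mem_ball n) (h.trans (map_zero φ).symm)
    simpa using congrFun this i
  · intro i j hij
    constructor
    · intro h
      have := inj _ (pair_mem hij (Or.inl rfl) (Or.inl rfl)) _ (single_mem j (Or.inr rfl))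
        (by
          rw [Pi.single_neg, map_add, map_neg, ← sub_eq_zero, ← h]
          change g i + g j - - g j = _
          abel)
      have := congrFun this i
      simp [hij] at this
    · intro h
      have := inj _ (pair_mem hij (Or.inl rfl) (Or.inr rfl)) _ (single_mem j (Or.inl rfl))
        (by
          rw [Pi.single_neg, map_add, map_neg, ← sub_eq_zero, ← h]
          change g i + - g j - g j = _
          abel)
      have := congrFun this i
      simp [hij] at this
  · intro R _
    have e1 : gS R G = ∑ b, eE R (φ (bVec n b)) := (Equiv.sum_comp eq (fun x => eE R x)).symm
    rw [e1, Fintype.sum_sum_type, Fintype.sum_sum_type, Fintype.sum_prod_type,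
      Fintype.sum_prod_type, ← add_assoc]
    congr 1
    · congr 1
      · simp [bVec, eE_zero]
      · refine Finset.sum_congr rfl fun i _ => ?_
        simp only [bVec, Fintype.sum_bool, hg1, hg2]
    · rw [← Fintype.sum_prod_type' (f := fun i j => if i < j then
        (eE R (g i) + eE R (-g i)) * (eE R (g j) + eE R (-g j)) else 0), ← Finset.sum_filter,
        Finset.sum_subtype (p := fun p : Fin n × Fin n => p.1 < p.2) _ (by simp)]
      refine Finset.sum_congr rfl fun p _ => ?_
      rw [Fintype.sum_prod_type]
      simp only [bVec, Fintype.sum_bool, map_add, hg1, hg2, ← eE_mul]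
      ring
end

section
/- Let n ≥ 3 be an integer and suppose 2n² + 1 = m·p where p is a prime with p > 2n + 1. Let b be the multiplicative order of 4 modulo p. If there exists a lattice tiling of ℤⁿ by the error ball B(n,2,1,1), then the set K = {k ∈ ℕ : p divides 4^k − 4n − 2} is nonempty and, writing a = min K, there exist nonnegative integers x, y and ℓ with 2ℓ² ≤ m − 1 such that a·(x + 1) + b·y = n − ℓ. -/
open Finset

theorem sum_lt_symm {n : ℕ} {R : Type*} [AddCommMonoid R] (H : Fin n → Fin n → R)
    (hs : ∀ i j, H i j = H j i) :
    2 • (∑ q : {q : Fin n × Fin n // q.1 < q.2}, H q.1.1 q.1.2) + ∑ i, H i i = ∑ i, ∑ j, H i j := by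
  have h1 : (∑ q : {q : Fin n × Fin n // q.1 < q.2}, H q.1.1 q.1.2)
      = ∑ i, ∑ j, if i < j then H i j else 0 := by
    rw [← Finset.sum_subtype (univ.filter fun q : Fin n × Fin n => q.1 < q.2) (by simp)
      (fun q => H q.1 q.2), Finset.sum_filter, Fintype.sum_prod_type]
  have h2 : (∑ i, ∑ j, if i < j then H i j else 0) = ∑ i, ∑ j, if j < i then H i j else 0 := by
    rw [Finset.sum_comm]
    simp only [hs]
  have h3 : ∑ i, H i i = ∑ i, ∑ j, if i = j then H i j else 0 := by simp
  rw [two_smul, h1]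
  nth_rewrite 2 [h2]
  rw [h3, ← Finset.sum_add_distrib, ← Finset.sum_add_distrib]
  refine Finset.sum_congr rfl fun i _ => ?_
  rw [← Finset.sum_add_distrib, ← Finset.sum_add_distrib]
  refine Finset.sum_congr rfl fun j _ => ?_
  rcases lt_trichotomy i j with h | h | h
  · simp [h, h.not_gt, h.ne]
  · simp [h]
  · simp [h, h.not_gt, h.ne']

theorem binom_step {n : ℕ} {R : Type*} [CommRing R] (a : Fin n → R) (k : ℕ) (hk : 1 ≤ k)
    (hmid : ∀ t, 1 ≤ t → t < k → (∑ i, a i ^ (2 * t)) * (∑ i, a i ^ (2 * (k - t))) = 0) :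
    ∑ i, ∑ j, ((a i + a j) ^ (2 * k) + (a i - a j) ^ (2 * k)) = 4 * n * ∑ i, a i ^ (2 * k) := by
  have key : ∀ i j, (a i + a j) ^ (2 * k) + (a i - a j) ^ (2 * k) =
      ∑ m ∈ range (2 * k + 1), (a i ^ m * a j ^ (2 * k - m)) *
        ((1 + (-1) ^ (2 * k - m)) * ((2 * k).choose m : R)) := by
    intro i j
    rw [sub_eq_add_neg, add_pow, add_pow, ← Finset.sum_add_distrib]
    refine Finset.sum_congr rfl fun m _ => ?_
    rw [neg_pow (a j)]
    ring
  simp_rw [key]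
  have sw : ∑ i, ∑ j, ∑ m ∈ range (2 * k + 1), (a i ^ m * a j ^ (2 * k - m)) *
        ((1 + (-1) ^ (2 * k - m)) * ((2 * k).choose m : R)) =
      ∑ m ∈ range (2 * k + 1), ((∑ i, a i ^ m) * (∑ j, a j ^ (2 * k - m))) *
        ((1 + (-1) ^ (2 * k - m)) * ((2 * k).choose m : R)) := by
    simp_rw [Finset.sum_mul_sum, Finset.sum_mul]
    symm
    rw [Finset.sum_comm]
    refine Finset.sum_congr rfl fun i _ => ?_
    rw [Finset.sum_comm]
  rw [sw, Finset.sum_range_succ]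
  obtain ⟨K, rfl⟩ : ∃ K, k = K + 1 := ⟨k - 1, by omega⟩
  rw [show 2 * (K + 1) = (2 * K + 1) + 1 by ring, Finset.sum_range_succ']
  rw [Finset.sum_eq_zero]
  · have e : (-1 : R) ^ (2 * K + 1 + 1) = 1 := Even.neg_one_pow ⟨K + 1, by ring⟩
    simp [e]; ring
  · intro m hm
    rw [Finset.mem_range] at hm
    rcases Nat.even_or_odd' m with ⟨c, rfl | rfl⟩
    · have e : (-1 : R) ^ (2 * K + 1 + 1 - (2 * c + 1)) = -1 :=
        Odd.neg_one_pow ⟨K - c, by omega⟩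
      rw [e]; simp
    · have := hmid (c + 1) (by omega) (by omega)
      rw [show 2 * c + 1 + 1 = 2 * (c + 1) by ring,
        show 2 * K + 1 + 1 - 2 * (c + 1) = 2 * (K + 1 - (c + 1)) by omega, this]
      simp

theorem esymm_ne {n : ℕ} {F : Type*} [Field F] [DecidableEq F] (x : Fin n → F) :
    MvPolynomial.aeval x (MvPolynomial.esymm (Fin n) F (univ.filter (fun i => x i ≠ 0)).card) ≠ 0 := by
  set N := univ.filter (fun i => x i ≠ 0) with hN
  rw [MvPolynomial.esymm, map_sum, Finset.sum_eq_single N]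
  · rw [map_prod]
    simp only [MvPolynomial.aeval_X]
    exact Finset.prod_ne_zero_iff.mpr fun i hi => (by simpa [hN] using hi)
  · intro t ht hne
    rw [map_prod]
    simp only [MvPolynomial.aeval_X]
    rw [Finset.mem_powersetCard] at ht
    by_contra h0
    rw [← ne_eq, Finset.prod_ne_zero_iff] at h0
    apply hne
    refine Finset.eq_of_subset_of_card_le (fun i hi => by simpa [hN] using h0 i hi) ht.2.ge
  · intro h
    simp at h

theorem esymm_Q {n p : ℕ} [Fact p.Prime] (hnp : n < p) (x : Fin n → ZMod p) (Q : ℕ → Prop)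
    (hadd : ∀ s t, Q s → Q t → Q (s + t))
    (hps : ∀ k, 1 ≤ k → k ≤ n → ∑ i, x i ^ k ≠ 0 → Q k) :
    ∀ k, 1 ≤ k → k ≤ n →
      MvPolynomial.aeval x (MvPolynomial.esymm (Fin n) (ZMod p) k) ≠ 0 → Q k := by
  intro k
  induction k using Nat.strong_induction_on with
  | _ k ih =>
    intro h1 hkn hne
    by_contra hQ
    have hN := congrArg (MvPolynomial.aeval x) (MvPolynomial.mul_esymm_eq_sum (Fin n) (ZMod p) k)
    simp only [map_mul, map_sum, map_natCast, map_pow, map_neg, map_one] at hN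
    rw [Finset.sum_eq_zero, mul_zero] at hN
    · rcases mul_eq_zero.mp hN with h | h
      · rw [ZMod.natCast_eq_zero_iff] at h
        exact absurd (Nat.le_of_dvd h1 h) (by omega)
      · exact hne h
    · rintro ⟨s, t⟩ hst
      simp only [Finset.mem_filter] at hst
      obtain ⟨hst, hs⟩ := hst
      have hst : s + t = k := Finset.HasAntidiagonal.mem_antidiagonal.mp hst
      have ps : MvPolynomial.aeval x (MvPolynomial.psum (Fin n) (ZMod p) t) = ∑ i, x i ^ t := by
        simp [MvPolynomial.psum]
      simp only [ps]
      by_contra h0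
      have hA : MvPolynomial.aeval x (MvPolynomial.esymm (Fin n) (ZMod p) s) ≠ 0 :=
        fun h => h0 (by rw [h]; ring)
      have hB : ∑ i, x i ^ t ≠ 0 := fun h => h0 (by rw [h]; ring)
      have qt := hps t (by omega) (by omega) hB
      rcases Nat.eq_zero_or_pos s with h | h
      · apply hQ; have : t = k := by omega
        exact this ▸ qt
      · exact hQ (hst ▸ hadd s t (ih s hs h (by omega) hA) qt)

abbrev BIdx (n : ℕ) : Type :=
  Unit ⊕ (Fin n × ℤˣ) ⊕ ({q : Fin n × Fin n // q.1 < q.2} × (ℤˣ × ℤˣ))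

def bvec (n : ℕ) : BIdx n → (Fin n → ℤ)
  | Sum.inl _ => 0
  | Sum.inr (Sum.inl (i, s)) => Pi.single i (s : ℤ)
  | Sum.inr (Sum.inr (q, s, t)) => Pi.single q.1.1 (s : ℤ) + Pi.single q.1.2 (t : ℤ)

theorem unit_cases (s : ℤˣ) : (s : ℤ) = 1 ∨ (s : ℤ) = -1 := by
  rcases Int.units_eq_one_or s with h | h <;> simp [h]

theorem bvec_inj (n : ℕ) : Function.Injective (bvec n) := by
  rintro (u | ⟨i, s⟩ | ⟨⟨⟨i, j⟩, hij⟩, s, t⟩) (u' | ⟨i', s'⟩ | ⟨⟨⟨i', j'⟩, hij'⟩, s', t'⟩) h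
  · rfl
  · exfalso
    have h1 := congrFun h i'
    simp [bvec] at h1
    have := unit_cases s'
    omega
  · exfalso
    have h1 := congrFun h i'
    simp only at hij'
    have := unit_cases s'
    simp [bvec, hij'.ne] at h1
    omega
  · exfalso
    have h1 := congrFun h i
    simp [bvec] at h1
  · have hi := congrFun h i
    have hi' := congrFun h i'
    have := unit_cases s
    have := unit_cases s'
    simp only [bvec, Pi.single_apply] at hi hi'
    have e : i = i' := by
      by_contra hne
      simp [hne] at hi
    subst e
    simp at hi
    rw [Units.ext hi]
  · exfalso
    simp only at hij'
    have hi := congrFun h i'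
    have hj := congrFun h j'
    have := unit_cases s'
    have := unit_cases t'
    simp only [bvec, Pi.single_apply, Pi.add_apply, hij'.ne, hij'.ne'] at hi hj
    split_ifs at hi hj with h1 h2 <;> omega
  · exfalso
    simp only at hij
    have hi := congrFun h i
    simp [bvec, hij.ne] at hi
  · exfalso
    simp only at hij
    have hi := congrFun h i
    have hj := congrFun h j
    have := unit_cases s
    have := unit_cases t
    simp only [bvec, Pi.single_apply, Pi.add_apply, hij.ne, hij.ne'] at hi hj
    split_ifs at hi hj with h1 h2 <;> omega
  · simp only at hij hij'
    have := unit_cases s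
    have := unit_cases t
    have := unit_cases s'
    have := unit_cases t'
    have hi := congrFun h i
    have hj := congrFun h j
    have hi' := congrFun h i'
    have hj' := congrFun h j'
    simp only [bvec, Pi.single_apply, Pi.add_apply] at hi hj hi' hj'
    have e : i = i' ∧ j = j' ∧ (s : ℤ) = s' ∧ (t : ℤ) = t' := by grind
    obtain ⟨rfl, rfl, h3, h4⟩ := e
    rw [Units.ext h3, Units.ext h4]

theorem bvec_range (n : ℕ) : Set.range (bvec n) = errBall n := by
  ext v
  constructor
  · rintro ⟨(u | ⟨i, s⟩ | ⟨⟨⟨i, j⟩, hij⟩, s, t⟩), rfl⟩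
    · simp [bvec, errBall]
    · have := unit_cases s
      refine ⟨fun k => ?_, ?_⟩
      · simp only [bvec, Pi.single_apply]; split_ifs <;> omega
      · refine le_trans (Finset.card_le_card (t := {i}) ?_) (by simp)
        intro k hk
        by_contra hki
        simp at hki
        simp [bvec, Pi.single_apply, hki] at hk
    · have := unit_cases s
      have := unit_cases t
      simp only at hij
      refine ⟨fun k => ?_, ?_⟩
      · simp only [bvec, Pi.add_apply, Pi.single_apply]
        split_ifs with h1 h2
        · exact absurd (h1.symm.trans h2) hij.ne
        all_goals omega
      · refine le_trans (Finset.card_le_card (t := {i, j}) ?_) Finset.card_le_two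
        intro k hk
        by_contra hki
        simp at hki
        simp [bvec, Pi.single_apply, hki] at hk
  · rintro ⟨h1, h2⟩
    have hu : ∀ i, v i ≠ 0 → ∃ s : ℤˣ, (s : ℤ) = v i := by
      intro i hi
      rcases h1 i with h | h | h
      · exact ⟨-1, by simp [h]⟩
      · exact absurd h hi
      · exact ⟨1, by simp [h]⟩
    have hcard : (Finset.univ.filter (fun i => v i ≠ 0)).card = 0 ∨
      (Finset.univ.filter (fun i => v i ≠ 0)).card = 1 ∨
      (Finset.univ.filter (fun i => v i ≠ 0)).card = 2 := by omega
    rcases hcard with h | h | h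
    · refine ⟨Sum.inl (), ?_⟩
      rw [Finset.card_eq_zero] at h
      funext i
      by_contra hne
      have : i ∈ Finset.univ.filter (fun i => v i ≠ 0) := by simpa [bvec, eq_comm] using hne
      simp [h] at this
    · obtain ⟨i, hi⟩ := Finset.card_eq_one.mp h
      have hm : ∀ k, v k ≠ 0 ↔ k = i := fun k => by
        have := Finset.ext_iff.mp hi k
        simpa using this
      obtain ⟨s, hs⟩ := hu i ((hm i).2 rfl)
      refine ⟨Sum.inr (Sum.inl (i, s)), ?_⟩
      funext k
      simp only [bvec, Pi.single_apply]
      have := hm k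
      grind
    · obtain ⟨i, j, hij, hi⟩ := Finset.card_eq_two.mp h
      have key : ∀ i j : Fin n, i < j → (∀ k, v k ≠ 0 ↔ k = i ∨ k = j) → v ∈ Set.range (bvec n) := by
        intro i j hij hm
        obtain ⟨s, hs⟩ := hu i ((hm i).2 (Or.inl rfl))
        obtain ⟨t, ht⟩ := hu j ((hm j).2 (Or.inr rfl))
        refine ⟨Sum.inr (Sum.inr (⟨(i, j), hij⟩, s, t)), ?_⟩
        funext k
        simp only [bvec, Pi.single_apply, Pi.add_apply]
        have := hm k
        grind
      have hm : ∀ k, v k ≠ 0 ↔ k = i ∨ k = j := fun k => by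
        have := Finset.ext_iff.mp hi k
        simpa using this
      rcases lt_or_gt_of_ne hij with h' | h'
      · exact key i j h' hm
      · exact key j i h' fun k => (hm k).trans or_comm

theorem quot_bij (n : ℕ) (L : AddSubgroup (Fin n → ℤ)) (h : IsLatticeTiling n (errBall n) L) :
    Function.Bijective (fun c : BIdx n => (QuotientAddGroup.mk (bvec n c) : (Fin n → ℤ) ⧸ L)) := by
  constructor
  · intro c d hcd
    have hcd : -(bvec n c) + bvec n d ∈ L := QuotientAddGroup.eq.mp hcd
    apply bvec_inj n
    have := (h (bvec n d)).unique (y₁ := (bvec n d, 0)) (y₂ := (bvec n c, -(bvec n c) + bvec n d))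
      ⟨by rw [← bvec_range]; exact ⟨d, rfl⟩, L.zero_mem, by simp⟩
      ⟨by rw [← bvec_range]; exact ⟨c, rfl⟩, hcd, by simp⟩
    exact (congrArg Prod.fst this).symm
  · intro g
    obtain ⟨x, rfl⟩ := QuotientAddGroup.mk_surjective g
    obtain ⟨⟨v, l⟩, ⟨hv, hl, hx⟩, -⟩ := h x
    simp only at hv hl hx
    rw [← bvec_range] at hv
    obtain ⟨c, rfl⟩ := hv
    refine ⟨c, ?_⟩
    simp only
    rw [QuotientAddGroup.eq, hx]
    simpa using hl

theorem exists_hom_aux {V : Type*} [AddCommGroup V] (p : ℕ) [Fact p.Prime] [Module (ZMod p) V]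
    (v : V) (hv : v ≠ 0) : ∃ f : V →+ ZMod p, Function.Surjective f := by
  have := (Module.forall_dual_apply_eq_zero_iff (ZMod p) v).not.mpr hv
  rw [not_forall] at this
  obtain ⟨φ, hφ⟩ := this
  refine ⟨φ.toAddMonoidHom, fun c => ⟨(c / φ v) • v, ?_⟩⟩
  simp [hφ]

theorem exists_hom {G : Type*} [AddCommGroup G] [Finite G] (p : ℕ) [Fact p.Prime]
    (hp : p ∣ Nat.card G) : ∃ f : G →+ ZMod p, Function.Surjective f := by
  set μ : G →+ G := nsmulAddMonoidHom p with hμ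
  have hns : ¬ Function.Surjective μ := by
    intro hs
    have hi := Finite.injective_iff_surjective.mpr hs
    obtain ⟨x, hx⟩ := exists_prime_addOrderOf_dvd_card' (G := G) p hp
    have : x = 0 := hi (by simp [hμ, ← hx])
    rw [this] at hx
    simp at hx
    exact (Fact.out : p.Prime).ne_one hx.symm
  have : ∃ g, g ∉ μ.range := by
    by_contra hall
    push Not at hall
    exact hns fun g => hall g
  obtain ⟨g, hg⟩ := this
  have hq : (QuotientAddGroup.mk g : G ⧸ μ.range) ≠ 0 := by
    rwa [ne_eq, QuotientAddGroup.eq_zero_iff]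
  obtain ⟨φ, hφ⟩ := @exists_hom_aux (G ⧸ μ.range) _ p _
    (QuotientAddGroup.zmodModule (fun x => ⟨x, rfl⟩)) _ hq
  exact ⟨φ.comp (QuotientAddGroup.mk' μ.range), hφ.comp (QuotientAddGroup.mk'_surjective _)⟩

theorem sum_BIdx {n : ℕ} {R : Type*} [AddCommMonoid R] (F : BIdx n → R) :
    ∑ c, F c = F (Sum.inl ()) + (∑ i, ∑ s, F (Sum.inr (Sum.inl (i, s))) +
      ∑ q, ∑ s, ∑ t, F (Sum.inr (Sum.inr (q, s, t)))) := by
  simp [Fintype.sum_sum_type, Fintype.sum_prod_type]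

theorem sum_units {R : Type*} [AddCommMonoid R] (F : ℤˣ → R) : ∑ s, F s = F 1 + F (-1) := by
  rw [UnitsInt.univ, Finset.sum_pair (by decide)]

theorem card_BIdx (n : ℕ) : Fintype.card (BIdx n) = 2 * n ^ 2 + 1 := by
  have h := sum_lt_symm (n := n) (R := ℕ) (fun _ _ => 1) (fun _ _ => rfl)
  simp at h
  simp only [BIdx, Fintype.card_sum, Fintype.card_prod, Fintype.card_unit, Fintype.card_fin, Fintype.card_units_int]
  nlinarith

theorem sum_hom {G : Type*} [AddCommGroup G] [Fintype G] (p : ℕ) [Fact p.Prime]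
    (f : G →+ ZMod p) (hf : Function.Surjective f) {R : Type*} [AddCommMonoid R] (F : ZMod p → R) (m : ℕ) (hG : Fintype.card G = m * p) :
    ∑ g, F (f g) = m • ∑ z, F z := by
  have hc : ∀ z, (univ.filter fun g => f g = z).card = (univ.filter fun g => f g = 0).card :=
    fun z => AddMonoidHom.card_fiber_eq_of_mem_range f (hf z) (hf 0)
  have h0 : (univ.filter fun g => f g = 0).card = m := by
    have : Fintype.card G = ∑ z, (univ.filter fun g => f g = z).card := by
      rw [← Finset.card_univ]
      exact Finset.card_eq_sum_card_fiberwise (by simp)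
    simp only [hc, Finset.sum_const, Finset.card_univ, ZMod.card, smul_eq_mul] at this
    rw [hG, mul_comm] at this
    exact (Nat.eq_of_mul_eq_mul_left (Fact.out : p.Prime).pos this).symm
  rw [← Finset.sum_fiberwise univ f, Finset.smul_sum]
  refine Finset.sum_congr rfl fun z _ => ?_
  rw [Finset.sum_congr rfl (g := fun _ => F z) (by intro g hg; simp at hg; rw [hg]), Finset.sum_const, hc, h0]

theorem psum_Q {n p : ℕ} [Fact p.Prime] (hp2 : 2 * n + 1 < p) (a : Fin n → ZMod p)
    (hsum : ∀ k, 1 ≤ k → 2 * k < p - 1 → ∑ i, (a i ^ (2 * k) + (-a i) ^ (2 * k)) +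
      ∑ q : {q : Fin n × Fin n // q.1 < q.2}, ((a q.1.1 + a q.1.2) ^ (2 * k) +
        (a q.1.1 - a q.1.2) ^ (2 * k) + ((-a q.1.1 + a q.1.2) ^ (2 * k) +
        (-a q.1.1 - a q.1.2) ^ (2 * k))) = 0)
    (Q : ℕ → Prop) (hadd : ∀ s t, Q s → Q t → Q (s + t))
    (hQ : ∀ k, (4 : ZMod p) ^ k = 4 * n + 2 → Q k) :
    ∀ k, 1 ≤ k → k ≤ n → ∑ i, (a i ^ 2) ^ k ≠ 0 → Q k := by
  intro k
  induction k using Nat.strong_induction_on with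
  | _ k ih =>
    intro h1 hkn hne
    by_contra hq
    have hodd : p % 2 = 1 := by
      rcases (Fact.out : p.Prime).eq_two_or_odd with h | h
      · omega
      · exact h
    have hs := hsum k h1 (by omega)
    simp only [← pow_mul] at hne ih
    have hb := binom_step a k h1 (by
      intro t ht htk
      by_contra h0
      have hA := left_ne_zero_of_mul h0
      have hB := right_ne_zero_of_mul h0
      have := hadd _ _ (ih t htk ht (by omega) hA) (ih (k - t) (by omega) (by omega) (by omega) hB)
      rw [show t + (k - t) = k by omega] at this
      exact hq this)
    have ev : Even (2 * k) := even_two_mul k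
    have hsym := sum_lt_symm (fun i j => (a i + a j) ^ (2 * k) + (a i - a j) ^ (2 * k)) (by
      intro i j
      rw [add_comm (a i), ← neg_sub (a j) (a i), ev.neg_pow])
    have hd : ∑ i, ((a i + a i) ^ (2 * k) + (a i - a i) ^ (2 * k)) = 4 ^ k * ∑ i, a i ^ (2 * k) := by
      rw [Finset.mul_sum]
      refine Finset.sum_congr rfl fun i _ => ?_
      rw [sub_self, zero_pow (by omega), ← two_mul, mul_pow, pow_mul 2 2 k]
      norm_num
    have e1 : ∀ x y : ZMod p, (-x + y) ^ (2 * k) = (x - y) ^ (2 * k) := by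
      intro x y
      rw [← ev.neg_pow]; congr 1; ring
    have e2 : ∀ x y : ZMod p, (-x - y) ^ (2 * k) = (x + y) ^ (2 * k) := by
      intro x y
      rw [← ev.neg_pow]; congr 1; ring
    simp only [e1, e2, ev.neg_pow] at hs
    simp only [hd, hb] at hsym
    have hs2 : 2 * ∑ i, a i ^ (2 * k) + 2 * ∑ q : {q : Fin n × Fin n // q.1 < q.2},
        ((a q.1.1 + a q.1.2) ^ (2 * k) + (a q.1.1 - a q.1.2) ^ (2 * k)) = 0 := by
      rw [← hs, Finset.mul_sum, Finset.mul_sum]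
      congr 1 <;> refine Finset.sum_congr rfl fun i _ => ?_ <;> ring
    rw [nsmul_eq_mul] at hsym
    push_cast at hsym
    have hfin : (4 ^ k - (4 * n + 2) : ZMod p) * ∑ i, a i ^ (2 * k) = 0 := by
      linear_combination hsym - hs2
    rcases mul_eq_zero.mp hfin with h | h
    · exact hq (hQ k (sub_eq_zero.mp h))
    · exact hne h

theorem main_sum (n m p : ℕ) [Fact p.Prime]
    (hfac : 2 * n ^ 2 + 1 = m * p)
    (htile : ∃ L : AddSubgroup (Fin n → ℤ), IsLatticeTiling n (errBall n) L) :
    ∃ a : Fin n → ZMod p, ∀ (R : Type) [AddCommMonoid R] (F : ZMod p → R),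
      F 0 + (∑ i, (F (a i) + F (-a i)) +
      ∑ q : {q : Fin n × Fin n // q.1 < q.2}, (F (a q.1.1 + a q.1.2) +
        F (a q.1.1 - a q.1.2) + (F (-a q.1.1 + a q.1.2) +
        F (-a q.1.1 - a q.1.2)))) = m • ∑ z, F z := by
  obtain ⟨L, hL⟩ := htile
  have hbij := quot_bij n L hL
  let e := Equiv.ofBijective _ hbij
  let _ : Fintype ((Fin n → ℤ) ⧸ L) := Fintype.ofEquiv _ e
  have hcard : Fintype.card ((Fin n → ℤ) ⧸ L) = m * p := by
    rw [← Fintype.card_congr e, card_BIdx, hfac]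
  obtain ⟨f, hf⟩ := exists_hom (G := (Fin n → ℤ) ⧸ L) p (by
    rw [Nat.card_eq_fintype_card, hcard]; exact dvd_mul_left _ _)
  let ψ : (Fin n → ℤ) →+ ZMod p := f.comp (QuotientAddGroup.mk' L)
  refine ⟨fun i => ψ (Pi.single i 1), ?_⟩
  intro R _ F
  rw [← sum_hom p f hf F m hcard, ← e.sum_comp]
  have : ∀ c, f (e c) = ψ (bvec n c) := fun c => rfl
  simp only [this]
  rw [sum_BIdx]
  simp only [sum_units, bvec, map_add, map_zero, Units.val_one, Units.val_neg, Pi.single_neg,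
    map_neg, sub_eq_add_neg]

theorem stmt19 (n m p : ℕ) (hn : 3 ≤ n) (hp : p.Prime)
    (hfac : 2 * n ^ 2 + 1 = m * p) (hplarge : 2 * n + 1 < p)
    (htile : ∃ L : AddSubgroup (Fin n → ℤ), IsLatticeTiling n (errBall n) L) :
    {k : ℕ | (p : ℤ) ∣ 4 ^ k - 4 * n - 2}.Nonempty ∧
    ∃ x y ℓ : ℕ, 2 * ℓ ^ 2 + 1 ≤ m ∧
      (sInf {k : ℕ | (p : ℤ) ∣ 4 ^ k - 4 * n - 2}) * (x + 1)
        + orderOf (4 : ZMod p) * y + ℓ = n := by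
  have : Fact p.Prime := ⟨hp⟩
  obtain ⟨a, ha⟩ := main_sum n m p hfac htile
  have hsum : ∀ k, 1 ≤ k → 2 * k < p - 1 → ∑ i, (a i ^ (2 * k) + (-a i) ^ (2 * k)) +
      ∑ q : {q : Fin n × Fin n // q.1 < q.2}, ((a q.1.1 + a q.1.2) ^ (2 * k) +
        (a q.1.1 - a q.1.2) ^ (2 * k) + ((-a q.1.1 + a q.1.2) ^ (2 * k) +
        (-a q.1.1 - a q.1.2) ^ (2 * k))) = 0 := by
    intro k h1 hk
    have h := ha (ZMod p) (fun z => z ^ (2 * k))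
    rw [FiniteField.sum_pow_lt_card_sub_one (ZMod p) (2 * k) (by rwa [ZMod.card])] at h
    simpa [zero_pow (show 2 * k ≠ 0 by omega)] using h
  set N := univ.filter (fun i => a i ^ 2 ≠ 0) with hN
  set Z := univ.filter (fun i => a i = 0) with hZ
  have hNZ : N.card + Z.card = n := by
    have := Finset.card_filter_add_card_filter_not (s := (univ : Finset (Fin n))) (fun i => a i = 0)
    simp only [Finset.card_univ, Fintype.card_fin] at this
    have hN' : N = univ.filter (fun i => ¬ a i = 0) := by
      rw [hN]; congr 1; funext i; simp
    rw [hN', hZ]; omega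
  have hNpos : 1 ≤ N.card := by
    by_contra hlt
    have h0 : N.card = 0 := by omega
    rw [Finset.card_eq_zero] at h0
    have hz : ∀ i, a i = 0 := by
      intro i
      by_contra hi
      have : i ∈ N := by simp [hN, hi]
      simp [h0] at this
    have h := ha ℕ (fun z => if z = 1 then 1 else 0)
    simp [hz] at h
    rw [← h] at hfac
    simp at hfac
  have hm : 2 * Z.card ^ 2 + 1 ≤ m := by
    have h := ha ℕ (fun z => if z = 0 then 1 else 0)
    simp only [Finset.sum_ite_eq', Finset.mem_univ, if_true, smul_eq_mul, mul_one] at h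
    have hsy := sum_lt_symm (R := ℕ) (n := n) (fun i j => if i ∈ Z ∧ j ∈ Z then 1 else 0)
      (fun i j => by simp only [and_comm])
    have hdbl : ∑ i : Fin n, ∑ j : Fin n, (if i ∈ Z ∧ j ∈ Z then 1 else 0) = Z.card * Z.card := by
      rw [← Fintype.sum_prod_type' (f := fun i j => if i ∈ Z ∧ j ∈ Z then 1 else 0),
        ← Finset.card_product]
      rw [Finset.sum_boole]
      simp only [Nat.cast_id]
      congr 1
      ext ⟨i, j⟩
      simp
    have hdg : ∑ i : Fin n, (if i ∈ Z ∧ i ∈ Z then 1 else 0) = Z.card := by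
      simp
    have l1 : 2 * Z.card ≤ ∑ i, ((if a i = 0 then 1 else 0) + if -a i = 0 then 1 else 0) := by
      simp [Finset.sum_add_distrib, hZ]; omega
    have l2 : 4 * ∑ q : {q : Fin n × Fin n // q.1 < q.2},
        (if q.1.1 ∈ Z ∧ q.1.2 ∈ Z then 1 else 0) ≤
        ∑ q : {q : Fin n × Fin n // q.1 < q.2}, ((if a q.1.1 + a q.1.2 = 0 then 1 else 0) +
        (if a q.1.1 - a q.1.2 = 0 then 1 else 0) + ((if -a q.1.1 + a q.1.2 = 0 then 1 else 0) +
        (if -a q.1.1 - a q.1.2 = 0 then 1 else 0))) := by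
      rw [Finset.mul_sum]
      refine Finset.sum_le_sum fun q _ => ?_
      by_cases hq : q.1.1 ∈ Z ∧ q.1.2 ∈ Z
      · have h1 : a q.1.1 = 0 := by simpa [hZ] using hq.1
        have h2 : a q.1.2 = 0 := by simpa [hZ] using hq.2
        simp [hq, h1, h2]
      · simp [hq]
    simp only [hdbl, hdg, smul_eq_mul] at hsy
    rw [sq]
    omega
  have hmain : ∀ (Q : ℕ → Prop), (∀ s t, Q s → Q t → Q (s + t)) →
      (∀ k, (4 : ZMod p) ^ k = 4 * n + 2 → Q k) → Q N.card := by
    intro Q hadd hQ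
    have h1 := psum_Q hplarge a hsum Q hadd hQ
    exact esymm_Q (by omega) (fun i => a i ^ 2) Q hadd h1 N.card hNpos (by omega)
      (esymm_ne (fun i => a i ^ 2))
  have hK : ∀ k : ℕ, k ∈ {k : ℕ | (p : ℤ) ∣ 4 ^ k - 4 * n - 2} ↔ (4 : ZMod p) ^ k = 4 * n + 2 := by
    intro k
    rw [Set.mem_setOf_eq, ← ZMod.intCast_zmod_eq_zero_iff_dvd]
    push_cast
    rw [sub_sub, sub_eq_zero]
  set K := {k : ℕ | (p : ℤ) ∣ 4 ^ k - 4 * n - 2} with hKdef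
  have hne : K.Nonempty :=
    hmain (fun _ => K.Nonempty) (fun _ _ h _ => h) (fun k hk => ⟨k, (hK k).2 hk⟩)
  refine ⟨hne, ?_⟩
  obtain ⟨x, y, hxy⟩ := hmain (fun k => ∃ x y, sInf K * (x + 1) + orderOf (4 : ZMod p) * y = k)
    (by
      rintro s t ⟨x, y, rfl⟩ ⟨x', y', rfl⟩
      exact ⟨x + x' + 1, y + y', by ring⟩)
    (by
      intro k hk
      have hle : sInf K ≤ k := Nat.sInf_le ((hK k).2 hk)
      have hin := (hK _).1 (Nat.sInf_mem hne)
      have h4 : (4 : ZMod p) ≠ 0 := by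
        intro h
        have h' : ((4 : ℕ) : ZMod p) = 0 := by exact_mod_cast h
        rw [ZMod.natCast_eq_zero_iff] at h'
        have := Nat.le_of_dvd (by norm_num) h'
        omega
      have h1 : (4 : ZMod p) ^ (k - sInf K) = 1 := by
        have : (4 : ZMod p) ^ sInf K * 4 ^ (k - sInf K) = 4 ^ sInf K * 1 := by
          rw [← pow_add, Nat.add_sub_cancel' hle, hk, hin, mul_one]
        exact mul_left_cancel₀ (pow_ne_zero _ h4) this
      obtain ⟨y, hy⟩ := orderOf_dvd_of_pow_eq_one h1
      exact ⟨0, y, by rw [← hy]; omega⟩)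
  exact ⟨x, y, Z.card, hm, by rw [hxy, hNZ]⟩
end
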